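/- arXiv:2502.20800 — 2 statements merged into one kernel-verified Lean document; each statement's English description precedes it below -/
import Mathlib

section
/- Let G be the simple group of order 168, and let H₁, …, H₈ be the eight conjugates in G of the subgroup H₁ = ⟨(1,4,2)(5,8,7), (1,8,2,4,3,7,5)⟩ of order 21. For each i, let η_i be the degree-1 character of H_i taking value ζ₃² on the specified order-3 generator t_i, and set e_{η_i} = (1/21) Σ_{h∈H_i} η_i(h⁻¹)h ∈ ℚ(ζ₃)[G]. Let e₆^G be the central idempotent of the irreducible character of G of degree 8. Then e₆^G = Σ_{i=1}^{8} e_{η_i}, and e_{η_i} e_{η_j} = δ_{ij} e_{η_i} for all i, j. -/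
open scoped Classical

/-- The idempotent `e_ψ^H = (1/|H|) ∑_{h∈H} ψ(h⁻¹) h` in the group algebra `K[G]`. -/
noncomputable def subIdem {G : Type} [Group G] [Fintype G] {K : Type} [Field K]
    (H : Subgroup G) (ψ : H → K) : MonoidAlgebra K G :=
  (Fintype.card H : K)⁻¹ • ∑ h : H, MonoidAlgebra.single (h : G) (ψ h⁻¹)

/-- The central idempotent `e_χ^G = (χ(1)/|G|) ∑_{g∈G} χ(g⁻¹) g`. -/
noncomputable def cenIdem {G : Type} [Group G] [Fintype G] {K : Type} [Field K]
    (χ : G → K) (d : K) : MonoidAlgebra K G :=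
  (d / (Fintype.card G : K)) • ∑ g : G, MonoidAlgebra.single g (χ g⁻¹)

/-- The conjugate subgroup `g H g⁻¹`. -/
def conjSub {G : Type} [Group G] (g : G) (H : Subgroup G) : Subgroup G :=
  Subgroup.map (MulAut.conj g).toMonoidHom H

open CategoryTheory in

theorem simple_sub {K G : Type} [Field K] [Group G] (V : FDRep K G)
    (hV : CategoryTheory.Simple V) (p : Submodule K V)
    (hp : ∀ g : G, ∀ v ∈ p, V.ρ g v ∈ p) (v : V) (hv : v ≠ 0) (hvp : v ∈ p) : p = ⊤ := by
  let σ : Subrepresentation V.ρ := ⟨p, fun g v hv => hp g v hv⟩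
  let W : FDRep K G := FDRep.of σ.toRepresentation
  let ι : W ⟶ V := ⟨CategoryTheory.InducedCategory.homMk (ModuleCat.ofHom p.subtype), fun g => by
    ext1
    rfl⟩
  have hmono : CategoryTheory.Mono ι := by
    constructor
    intro Z f g h
    ext z
    have h2 := congrArg (fun q : Z ⟶ V => q.hom.hom.hom z) h
    exact h2
  have hne : ι ≠ 0 := by
    intro h
    apply hv
    have h2 := congrArg (fun q : W ⟶ V => q.hom.hom.hom (⟨v, hvp⟩ : p)) h
    exact h2
  have hiso := (CategoryTheory.Simple.mono_isIso_iff_nonzero ι).2 hne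
  rw [eq_top_iff]
  intro x _
  have h3 : CategoryTheory.CategoryStruct.comp (CategoryTheory.inv ι) ι = CategoryTheory.CategoryStruct.id V :=
    CategoryTheory.IsIso.inv_hom_id ι
  have h4 := congrArg (fun q : V ⟶ V => q.hom.hom.hom x) h3
  have h5 : ((CategoryTheory.InducedCategory.Hom.hom (CategoryTheory.inv ι).hom).hom x : p).1 = x := h4
  rw [← h5]
  exact Subtype.mem _

theorem no_seven {K V : Type} [Field K] [Algebra ℚ K] [IsCyclotomicExtension {3} ℚ K]
    [AddCommGroup V] [Module K V] (hdim : Module.finrank K V = 8)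
    (f : V →ₗ[K] V) (hf : ∑ b ∈ Finset.range 7, f ^ b = 0) : False := by
  let : Module ℚ V := Module.compHom V (algebraMap ℚ K)
  have : IsScalarTower ℚ K V := ⟨fun a b v => by
    rw [Algebra.smul_def, mul_smul]; rfl⟩
  have hK : Module.finrank ℚ K = 2 := by
    rw [IsCyclotomicExtension.finrank (n := 3) K
      (Polynomial.cyclotomic.irreducible_rat (by norm_num))]
    decide
  have h16 : Module.finrank ℚ V = 16 := by
    rw [← Module.finrank_mul_finrank ℚ K V, hK, hdim]
  let f' : V →ₗ[ℚ] V := f.restrictScalars ℚ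
  have hpow : ∀ n : ℕ, f' ^ n = (f ^ n).restrictScalars ℚ := by
    intro n
    ext v
    rw [Module.End.pow_apply, LinearMap.restrictScalars_apply, Module.End.pow_apply]
    rfl
  have hf' : Polynomial.aeval f' (Polynomial.cyclotomic 7 ℚ) = 0 := by
    have : Fact (Nat.Prime 7) := ⟨by norm_num⟩
    rw [Polynomial.cyclotomic_prime, map_sum]
    ext v
    have := congrArg (fun q : V →ₗ[K] V => q v) hf
    simp only [LinearMap.sum_apply, LinearMap.zero_apply] at this ⊢
    rw [← this]
    refine Finset.sum_congr rfl fun n _ => ?_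
    rw [map_pow, Polynomial.aeval_X, hpow]
    rfl
  have hirr := Polynomial.cyclotomic.irreducible_rat (n := 7) (by norm_num)
  have : Fact (Irreducible (Polynomial.cyclotomic 7 ℚ)) := ⟨hirr⟩
  let φ : AdjoinRoot (Polynomial.cyclotomic 7 ℚ) →ₐ[ℚ] Module.End ℚ V :=
    Ideal.Quotient.liftₐ _ (Polynomial.aeval f') (by
      intro a ha
      obtain ⟨c, rfl⟩ := Ideal.mem_span_singleton.1 ha
      rw [map_mul, hf', zero_mul])
  let : Module (AdjoinRoot (Polynomial.cyclotomic 7 ℚ)) V := Module.compHom V φ.toRingHom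
  have : IsScalarTower ℚ (AdjoinRoot (Polynomial.cyclotomic 7 ℚ)) V := ⟨fun a b v => by
    change φ (a • b) v = a • φ b v
    rw [map_smul]; rfl⟩
  have h := Module.finrank_mul_finrank ℚ (AdjoinRoot (Polynomial.cyclotomic 7 ℚ)) V
  have h6 : Module.finrank ℚ (AdjoinRoot (Polynomial.cyclotomic 7 ℚ)) = 6 := by
    rw [(AdjoinRoot.powerBasis hirr.ne_zero).finrank, AdjoinRoot.powerBasis_dim,
      Polynomial.natDegree_cyclotomic]
    decide
  rw [h6, h16] at h
  omega

theorem H_form {G : Type} [Group G] (t s : G) (t3 : t ^ 3 = 1) (s7 : s ^ 7 = 1)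
    (st : s * t = t * s ^ 4) (h : G) (hh : h ∈ Subgroup.closure {t, s}) :
    ∃ a < 3, ∃ b < 7, h = t ^ a * s ^ b := by
  have tinv : t⁻¹ = t ^ 2 := by
    rw [inv_eq_iff_mul_eq_one, ← pow_succ', t3]
  have sinv : s⁻¹ = s ^ 6 := by
    rw [inv_eq_iff_mul_eq_one, ← pow_succ', s7]
  have key : ∃ a b : ℕ, h = t ^ a * s ^ b := by
    have hs : ∀ y, (∃ a b : ℕ, y = t ^ a * s ^ b) → ∃ a b : ℕ, s * y = t ^ a * s ^ b := by
      rintro y ⟨a, b, rfl⟩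
      have : ∀ a : ℕ, ∃ c : ℕ, s * t ^ a = t ^ a * s ^ c := by
        intro a
        have hsc : SemiconjBy t (s ^ 4) s := st.symm
        refine ⟨4 ^ a, ?_⟩
        induction a with
        | zero => simp
        | succ n ih =>
          have h2 : s ^ (4 ^ n) * t = t * s ^ (4 ^ (n + 1)) := by
            have := (hsc.pow_right (4 ^ n)).eq
            rw [← pow_mul] at this
            rw [← this]; congr 2; ring
          rw [pow_succ, ← mul_assoc, ih, mul_assoc, h2, ← mul_assoc]
      obtain ⟨c, hc⟩ := this a
      exact ⟨a, c + b, by rw [← mul_assoc, hc, mul_assoc, pow_add]⟩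
    have ht : ∀ y, (∃ a b : ℕ, y = t ^ a * s ^ b) → ∃ a b : ℕ, t * y = t ^ a * s ^ b := by
      rintro y ⟨a, b, rfl⟩
      exact ⟨a + 1, b, by rw [← mul_assoc, pow_succ']⟩
    induction hh using Subgroup.closure_induction_left with
    | one => exact ⟨0, 0, by simp⟩
    | mul_left x hx y hy ih =>
      rcases hx with rfl | rfl
      · exact ht _ ih
      · exact hs _ ih
    | inv_mul_cancel x hx y hy ih =>
      rcases hx with rfl | rfl
      · rw [tinv, pow_two, mul_assoc]; exact ht _ (ht _ ih)
      · rw [sinv]; simp only [pow_succ, pow_zero, one_mul, mul_assoc]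
        exact hs _ (hs _ (hs _ (hs _ (hs _ (hs _ ih)))))
  obtain ⟨a, b, rfl⟩ := key
  exact ⟨a % 3, Nat.mod_lt _ (by norm_num), b % 7, Nat.mod_lt _ (by norm_num), by
    rw [← pow_eq_pow_mod a t3, ← pow_eq_pow_mod b s7]⟩

def inM {G : Type} [Group G] (H : Subgroup G) (w g : G) : Prop :=
  g ∈ H ∨ ∃ h ∈ H, ∃ h' ∈ H, g = h * w * h'

theorem inM_H {G : Type} [Group G] {H : Subgroup G} {w : G} {h y : G} (hh : h ∈ H)
    (hy : inM H w y) : inM H w (h * y) := by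
  rcases hy with hy | ⟨a, ha, b, hb, rfl⟩
  · exact Or.inl (H.mul_mem hh hy)
  · exact Or.inr ⟨h * a, H.mul_mem hh ha, b, hb, by group⟩

theorem inM_H' {G : Type} [Group G] {H : Subgroup G} {w : G} {h y : G} (hh : h ∈ H)
    (hy : inM H w y) : inM H w (y * h) := by
  rcases hy with hy | ⟨a, ha, b, hb, rfl⟩
  · exact Or.inl (H.mul_mem hy hh)
  · exact Or.inr ⟨a, ha, b * h, H.mul_mem hb hh, by group⟩

theorem w_pow {G : Type} [Group G] {t w : G} (w2 : w * w = 1)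
    (wt : w * t * w = t⁻¹) (a : ℕ) : w * t ^ a = (t ^ a)⁻¹ * w := by
  have winv : w⁻¹ = w := inv_eq_of_mul_eq_one_left w2
  have : (w * t * w⁻¹) ^ a = (t ^ a)⁻¹ := by rw [winv, wt, inv_pow]
  rw [← this, conj_pow]; group

theorem inM_w {G : Type} [Group G] {t s w : G} (t3 : t ^ 3 = 1) (s7 : s ^ 7 = 1)
    (st : s * t = t * s ^ 4) (w2 : w * w = 1) (wt : w * t * w = t⁻¹)
    (hw : ∀ b < 7, inM (Subgroup.closure {t, s}) w (w * s ^ b * w)) {y : G}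
    (hy : inM (Subgroup.closure {t, s}) w y) : inM (Subgroup.closure {t, s}) w (w * y) := by
  rcases hy with hy | ⟨h, hh, h', hh', rfl⟩
  · exact Or.inr ⟨1, one_mem _, y, hy, by group⟩
  · obtain ⟨a, ha, b, hb, rfl⟩ := H_form t s t3 s7 st h hh
    have : w * (t ^ a * s ^ b * w * h') = (t ^ a)⁻¹ * ((w * s ^ b * w) * h') := by
      rw [← mul_assoc, ← mul_assoc, ← mul_assoc, w_pow w2 wt]; group
    rw [this]
    refine inM_H (inv_mem (pow_mem (Subgroup.subset_closure (by simp)) _)) (inM_H' hh' (hw b hb))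

/-- Reindexing a sum over `H`. -/
theorem H_sum {G K : Type} [Group G] [Fintype G] [Field K] (t s : G)
    (t3 : t ^ 3 = 1) (s7 : s ^ 7 = 1)
    (st : s * t = t * s ^ 4) (hc : Nat.card (Subgroup.closure {t, s}) = 21) (f : G → K)
    (hf : ∀ g, g ∉ Subgroup.closure {t, s} → f g = 0) :
    ∑ g, f g = ∑ a ∈ Finset.range 3, ∑ b ∈ Finset.range 7, f (t ^ a * s ^ b) := by
  rw [← Finset.sum_product']
  let S : Finset G := Finset.univ.filter (· ∈ Subgroup.closure {t, s})
  have hS : S.card = 21 := by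
    rw [← hc, Nat.card_eq_fintype_card, Fintype.card_subtype]
  have hS2 : ∑ g, f g = ∑ g ∈ S, f g := by
    symm
    apply Finset.sum_subset (Finset.subset_univ _)
    intro g _ hg
    exact hf g (by simpa [S] using hg)
  have himg : (Finset.range 3 ×ˢ Finset.range 7).image (fun p : ℕ × ℕ => t ^ p.1 * s ^ p.2) = S := by
    ext g
    simp only [Finset.mem_image, Finset.mem_product, Finset.mem_range, Prod.exists, S,
      Finset.mem_filter, Finset.mem_univ, true_and]
    constructor
    · rintro ⟨a, b, -, rfl⟩
      exact mul_mem (pow_mem (Subgroup.subset_closure (by simp)) _)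
        (pow_mem (Subgroup.subset_closure (by simp)) _)
    · intro hg
      obtain ⟨a, ha, b, hb, rfl⟩ := H_form t s t3 s7 st g hg
      exact ⟨a, b, ⟨ha, hb⟩, rfl⟩
  have hinj : Set.InjOn (fun p : ℕ × ℕ => t ^ p.1 * s ^ p.2)
      (Finset.range 3 ×ˢ Finset.range 7 : Finset (ℕ × ℕ)) := by
    apply Finset.card_image_iff.1
    rw [himg, hS]; simp
  rw [hS2, ← himg, Finset.sum_image hinj]

/-- `E` is a linear character of `H`, extended by zero to `G`. -/
structure IsE {G K : Type} [Group G] [Field K] (H : Subgroup G) (E : G → K) : Prop where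
  one : E 1 = 1
  off : ∀ g, g ∉ H → E g = 0
  mul_left : ∀ h g, h ∈ H → E (h * g) = E h * E g
  mul_right : ∀ g h, h ∈ H → E (g * h) = E g * E h

/-- The idempotent attached to `E`. -/
noncomputable def idem {G K : Type} [Group G] [Fintype G] [Field K] (E : G → K) :
    MonoidAlgebra K G :=
  (21 : K)⁻¹ • ∑ g : G, MonoidAlgebra.single g (E g⁻¹)

theorem IsE.inv_mul {G K : Type} [Group G] [Field K] {H : Subgroup G} {E : G → K}
    (hE : IsE H E) {h : G} (hh : h ∈ H) : E h⁻¹ * E h = 1 := by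
  rw [← hE.mul_left _ _ (inv_mem hh), inv_mul_cancel, hE.one]

section
variable {G K : Type} [Group G] [Fintype G] [Field K] {H : Subgroup G} {E : G → K}

theorem idem_apply (E : G → K) (g : G) : (idem E).coeff g = (21 : K)⁻¹ * E g⁻¹ := by
  unfold idem
  rw [MonoidAlgebra.coeff_smul_apply, smul_eq_mul]
  congr 1
  rw [MonoidAlgebra.coeff_sum, Finsupp.finsetSum_apply]
  rw [Finset.sum_eq_single g]
  · simp
  · intro b _ hb
    simp [hb]
  · simp

theorem single_mul_idem (hE : IsE H E) {h : G} (hh : h ∈ H) :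
    MonoidAlgebra.single h 1 * idem E = E h • idem E := by
  ext g
  rw [MonoidAlgebra.coeff_single_mul_apply, MonoidAlgebra.coeff_smul_apply, idem_apply, idem_apply,
    mul_inv_rev, inv_inv, hE.mul_right _ _ hh, smul_eq_mul]
  ring

theorem idem_mul_single (hE : IsE H E) {h : G} (hh : h ∈ H) :
    idem E * MonoidAlgebra.single h 1 = E h • idem E := by
  ext g
  rw [MonoidAlgebra.coeff_mul_single_apply, MonoidAlgebra.coeff_smul_apply, idem_apply, idem_apply,
    mul_inv_rev, inv_inv, hE.mul_left _ _ hh, smul_eq_mul]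
  ring

theorem idem_mul_idem [CharZero K] (hE : IsE H E) (hc : Nat.card H = 21) :
    idem E * idem E = idem E := by
  have h1 : idem E * idem E = ((21 : K)⁻¹ * ∑ g : G, E g⁻¹ * E g) • idem E := by
    have h0 : idem E = (21 : K)⁻¹ • ∑ g : G, MonoidAlgebra.single g (E g⁻¹) := rfl
    conv_lhs => lhs; rw [h0]
    rw [smul_mul_assoc, Finset.sum_mul, mul_smul, Finset.sum_smul]
    congr 1
    refine Finset.sum_congr rfl fun g _ => ?_
    by_cases hg : g ∈ H
    · rw [mul_smul, ← single_mul_idem hE hg, ← smul_mul_assoc]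
      simp
    · rw [hE.off g hg, hE.off g⁻¹ (fun h => hg (by simpa using inv_mem h))]
      simp
  have h2 : ∑ g : G, E g⁻¹ * E g = 21 := by
    have : ∀ g : G, E g⁻¹ * E g = if g ∈ H then 1 else 0 := by
      intro g
      split_ifs with hg
      · exact hE.inv_mul hg
      · rw [hE.off g hg, mul_zero]
    simp only [this]
    rw [Finset.sum_boole, ← Fintype.card_subtype]
    have : Fintype.card {x // x ∈ H} = 21 := by rw [← hc, Nat.card_eq_fintype_card]
    rw [this]; norm_num
  rw [h1, h2, inv_mul_cancel₀ (by norm_num), one_smul]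

/-- The conjugated idempotent. -/
noncomputable def cidem (E : G → K) (x : G) : MonoidAlgebra K G :=
  MonoidAlgebra.single x 1 * idem E * MonoidAlgebra.single x⁻¹ 1

theorem cidem_apply (E : G → K) (x g : G) :
    (cidem E x).coeff g = (21 : K)⁻¹ * E (x⁻¹ * g⁻¹ * x) := by
  rw [cidem, MonoidAlgebra.coeff_mul_single_apply, MonoidAlgebra.coeff_single_mul_apply, idem_apply]
  simp [mul_assoc]

theorem single_inv_mul (x : G) :
    (MonoidAlgebra.single x⁻¹ 1 : MonoidAlgebra K G) * MonoidAlgebra.single x 1 = 1 := by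
  rw [MonoidAlgebra.single_mul_single, inv_mul_cancel, one_mul]; rfl

theorem cidem_mul_cidem [CharZero K] (hE : IsE H E) (hc : Nat.card H = 21)
    (horth : ∀ g, g ∉ H → idem E * MonoidAlgebra.single g 1 * idem E = 0)
    (x : Fin 8 → G) (hdis : ∀ i j, (x i)⁻¹ * x j ∈ H → i = j) (i j : Fin 8) :
    cidem E (x i) * cidem E (x j) = if i = j then cidem E (x i) else 0 := by
  split_ifs with hij
  · subst hij
    unfold cidem
    calc _ = MonoidAlgebra.single (x i) 1 * idem E *
          (MonoidAlgebra.single (x i)⁻¹ 1 * MonoidAlgebra.single (x i) 1) * idem E *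
            MonoidAlgebra.single (x i)⁻¹ 1 := by simp only [mul_assoc]
      _ = _ := by rw [single_inv_mul, mul_one, mul_assoc _ (idem E) (idem E),
                    idem_mul_idem hE hc]
  · have h := horth ((x i)⁻¹ * x j) (fun h => hij (hdis i j h))
    unfold cidem
    calc _ = MonoidAlgebra.single (x i) 1 * (idem E *
          (MonoidAlgebra.single (x i)⁻¹ 1 * MonoidAlgebra.single (x j) 1) * idem E) *
            MonoidAlgebra.single (x j)⁻¹ 1 := by simp only [mul_assoc]
      _ = _ := by rw [MonoidAlgebra.single_mul_single, one_mul, h]; simp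

/-- Vanishing of `e g e` off `H`. -/
theorem orth_of_w (hE : IsE H E) {t w : G} (ht : t ∈ H) (hM : ∀ g, inM H w g)
    (wt : t * w = w * t⁻¹) (hne : E t ≠ E t⁻¹) (g : G) (hg : g ∉ H) :
    idem E * MonoidAlgebra.single g 1 * idem E = 0 := by
  have hw : idem E * MonoidAlgebra.single w 1 * idem E = 0 := by
    have h1 : idem E * MonoidAlgebra.single (t * w) 1 * idem E =
        E t • (idem E * MonoidAlgebra.single w 1 * idem E) := by
      rw [← one_mul (1 : K), ← MonoidAlgebra.single_mul_single, ← mul_assoc,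
        idem_mul_single hE ht]
      simp
    have h2 : idem E * MonoidAlgebra.single (w * t⁻¹) 1 * idem E =
        E t⁻¹ • (idem E * MonoidAlgebra.single w 1 * idem E) := by
      rw [← one_mul (1 : K), ← MonoidAlgebra.single_mul_single, mul_assoc, mul_assoc,
        single_mul_idem hE (inv_mem ht)]
      simp [mul_assoc]
    rw [wt, h2] at h1
    have h3 : (E t - E t⁻¹) • (idem E * MonoidAlgebra.single w 1 * idem E) = 0 := by
      rw [sub_smul, h1, sub_self]
    exact (smul_eq_zero.1 h3).resolve_left (sub_ne_zero.2 hne)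
  rcases hM g with h | ⟨a, ha, b, hb, rfl⟩
  · exact absurd h hg
  · have : (MonoidAlgebra.single (a * w * b) 1 : MonoidAlgebra K G) =
        MonoidAlgebra.single a 1 * MonoidAlgebra.single w 1 * MonoidAlgebra.single b 1 := by
      simp [MonoidAlgebra.single_mul_single]
    rw [this]
    calc _ = (idem E * MonoidAlgebra.single a 1) * MonoidAlgebra.single w 1 *
          (MonoidAlgebra.single b 1 * idem E) := by simp only [mul_assoc]
      _ = 0 := by
        rw [idem_mul_single hE ha, single_mul_idem hE hb]
        simp only [smul_mul_assoc, mul_smul_comm, hw, smul_zero]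

end

section
variable {G K V : Type} [Group G] [Fintype G] [Field K] {H : Subgroup G} {E : G → K}
  [AddCommGroup V] [Module K V] {ρ : Representation K G V}

/-- Irreducibility in elementary terms. -/
def Irr (ρ : Representation K G V) : Prop :=
  ∀ p : Submodule K V, (∀ g : G, ∀ v ∈ p, ρ g v ∈ p) → ∀ v : V, v ≠ 0 → v ∈ p → p = ⊤

theorem span_top (hirr : Irr ρ) (x : Fin 8 → G)
    (hcov : ∀ g, ∃ k, (x k)⁻¹ * g ∈ H) (v : V) (hv : v ≠ 0)
    (hEv : ∀ h ∈ H, ρ h v = E h • v) :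
    Submodule.span K (Set.range fun k => ρ (x k) v) = ⊤ := by
  have key : ∀ g : G, ρ g v ∈ Submodule.span K (Set.range fun k => ρ (x k) v) := by
    intro g
    obtain ⟨k, hk⟩ := hcov g
    have : ρ g v = E ((x k)⁻¹ * g) • ρ (x k) v := by
      rw [← map_smul, ← hEv _ hk, ← Module.End.mul_apply, ← map_mul, mul_inv_cancel_left]
    rw [this]
    exact Submodule.smul_mem _ _ (Submodule.subset_span ⟨k, rfl⟩)
  refine hirr _ ?_ v hv ?_
  · intro g u hu
    induction hu using Submodule.span_induction with
    | mem y hy =>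
      obtain ⟨k, rfl⟩ := hy
      simp only
      rw [← Module.End.mul_apply, ← map_mul]
      exact key _
    | zero => simp
    | add a b _ _ ha hb => rw [map_add]; exact add_mem ha hb
    | smul c a _ ha => rw [map_smul]; exact Submodule.smul_mem _ _ ha
  · simpa using key 1

theorem idem_vec (hE : IsE H E) (v : V) (h : G) (hh : h ∈ H) :
    ρ h (ρ.asAlgebraHom (idem E) v) = E h • ρ.asAlgebraHom (idem E) v := by
  rw [← ρ.asAlgebraHom_single_one h, ← Module.End.mul_apply, ← map_mul, single_mul_idem hE hh,
    map_smul]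
  rfl

theorem trace_idem (E : G → K) : LinearMap.trace K V (ρ.asAlgebraHom (idem E)) =
    (21 : K)⁻¹ * ∑ g, E g⁻¹ * LinearMap.trace K V (ρ g) := by
  unfold idem
  rw [map_smul, map_smul, map_sum, map_sum, smul_eq_mul]
  congr 1
  refine Finset.sum_congr rfl fun g _ => ?_
  rw [Representation.asAlgebraHom_single, map_smul, smul_eq_mul]

theorem triv_zero [CharZero K] (hE : IsE H E) (hE1 : ∀ h ∈ H, E h = 1) (hirr : Irr ρ)
    (hdim : Module.finrank K V = 8) (hc : Nat.card H = 21) (x : Fin 8 → G)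
    (hcov : ∀ g, ∃ k, (x k)⁻¹ * g ∈ H) (hdis : ∀ i j, (x i)⁻¹ * x j ∈ H → i = j) :
    ρ.asAlgebraHom (idem E) = 0 := by
  by_contra hne
  obtain ⟨v', hv'⟩ : ∃ v', ρ.asAlgebraHom (idem E) v' ≠ 0 := by
    by_contra h
    push Not at h
    exact hne (LinearMap.ext h)
  set v := ρ.asAlgebraHom (idem E) v' with hvdef
  have hEv : ∀ h ∈ H, ρ h v = E h • v := fun h hh => idem_vec hE v' h hh
  clear_value v
  have hspan := span_top hirr x hcov v hv' hEv
  have hli : LinearIndependent K (fun k => ρ (x k) v) :=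
    linearIndependent_of_top_le_span_of_card_eq_finrank hspan.ge (by rw [hdim]; simp)
  -- the map `k` of the covering
  choose κ hκ using hcov
  have hgv : ∀ g, ρ g v = ρ (x (κ g)) v := by
    intro g
    have h1 := hEv _ (hκ g)
    rw [hE1 _ (hκ g), one_smul] at h1
    conv_rhs => rw [← h1]
    rw [← Module.End.mul_apply, ← map_mul, mul_inv_cancel_left]
  have hu : ∑ k, ρ (x k) v ≠ 0 := by
    intro h0
    have := Fintype.linearIndependent_iff.1 hli (fun _ => 1) (by simpa using h0) 0
    exact one_ne_zero this
  have hfix : ∀ g, ρ g (∑ k, ρ (x k) v) = ∑ k, ρ (x k) v := by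
    intro g
    rw [map_sum]
    have hinj : Function.Injective (fun k => κ (g * x k)) := by
      intro i j hij
      apply hdis
      have h1 := hκ (g * x i)
      have h2 := hκ (g * x j)
      simp only at hij
      rw [hij] at h1
      have := H.mul_mem (H.inv_mem h1) h2
      convert this using 1
      group
    have hbij := Finite.injective_iff_bijective.1 hinj
    have : ∀ k, ρ g (ρ (x k) v) = ρ (x (κ (g * x k))) v := by
      intro k
      rw [← Module.End.mul_apply, ← map_mul, hgv]
    simp only [this]
    exact Function.Bijective.sum_comp hbij (fun k => ρ (x k) v)
  have htop := hirr (Submodule.span K {∑ k, ρ (x k) v}) (by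
    intro g u hu
    obtain ⟨c, rfl⟩ := Submodule.mem_span_singleton.1 hu
    rw [map_smul, hfix]
    exact hu) _ hu (Submodule.mem_span_singleton_self _)
  have h1 := finrank_span_singleton (K := K) hu
  rw [htop, finrank_top, hdim] at h1
  norm_num at h1

theorem char_formula [CharZero K] (hE : IsE H E) (hirr : Irr ρ)
    (hdim : Module.finrank K V = 8) (hc : Nat.card H = 21) (x : Fin 8 → G)
    (hcov : ∀ g, ∃ k, (x k)⁻¹ * g ∈ H) (hdis : ∀ i j, (x i)⁻¹ * x j ∈ H → i = j)
    (horth : ∀ g, g ∉ H → idem E * MonoidAlgebra.single g 1 * idem E = 0)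
    (hne : ρ.asAlgebraHom (idem E) ≠ 0) (g : G) :
    LinearMap.trace K V (ρ g) = ∑ i, E ((x i)⁻¹ * g * x i) := by
  obtain ⟨v', hv'⟩ : ∃ v', ρ.asAlgebraHom (idem E) v' ≠ 0 := by
    by_contra h
    push Not at h
    exact hne (LinearMap.ext h)
  set v := ρ.asAlgebraHom (idem E) v' with hvdef
  have hEv : ∀ h ∈ H, ρ h v = E h • v := fun h hh => idem_vec hE v' h hh
  have hspan := span_top hirr x hcov v hv' hEv
  have hmul := cidem_mul_cidem hE hc horth x hdis
  have hv2 : ρ.asAlgebraHom (idem E) v = v := by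
    rw [hvdef, ← Module.End.mul_apply, ← map_mul, idem_mul_idem hE hc]
  have hkv : ∀ k, ρ.asAlgebraHom (cidem E (x k)) (ρ (x k) v) = ρ (x k) v := by
    intro k
    unfold cidem
    rw [map_mul, map_mul, ρ.asAlgebraHom_single_one, ρ.asAlgebraHom_single_one,
      Module.End.mul_apply, Module.End.mul_apply, ← Module.End.mul_apply (ρ (x k)⁻¹), ← map_mul,
      inv_mul_cancel, map_one, Module.End.one_apply, hv2]
  have hone : ρ.asAlgebraHom (∑ i, cidem E (x i)) = 1 := by
    apply LinearMap.ext_on_range hspan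
    intro k
    conv_lhs => rw [← hkv k]
    rw [← Module.End.mul_apply, ← map_mul, Finset.sum_mul]
    simp only [hmul]
    simp only [Finset.sum_ite_eq', Finset.mem_univ, if_true]
    rw [hkv, Module.End.one_apply]
  have htr : ∀ (y : G) (a : G), LinearMap.trace K V
      (ρ a * ρ.asAlgebraHom (cidem E y)) =
      E (y⁻¹ * a * y) * LinearMap.trace K V (ρ.asAlgebraHom (idem E)) := by
    intro y a
    have h1 : ρ a * ρ.asAlgebraHom (cidem E y) =
        (ρ a * ρ y * ρ.asAlgebraHom (idem E)) * (ρ.asAlgebraHom (idem E) * ρ y⁻¹) := by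
      conv_lhs => rw [cidem, ← idem_mul_idem hE hc]
      simp only [map_mul, ρ.asAlgebraHom_single_one, mul_assoc]
    rw [h1, LinearMap.trace_mul_comm]
    have h2 : (ρ.asAlgebraHom (idem E) * ρ y⁻¹) * (ρ a * ρ y * ρ.asAlgebraHom (idem E)) =
        ρ.asAlgebraHom (idem E * MonoidAlgebra.single (y⁻¹ * a * y) 1 * idem E) := by
      simp only [map_mul, ρ.asAlgebraHom_single_one, mul_assoc]
    rw [h2]
    by_cases hy : y⁻¹ * a * y ∈ H
    · rw [idem_mul_single hE hy, smul_mul_assoc, idem_mul_idem hE hc, map_smul, map_smul,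
        smul_eq_mul]
    · rw [horth _ hy, hE.off _ hy]; simp
  have hsum : ∀ a : G, LinearMap.trace K V (ρ a) =
      (∑ i, E ((x i)⁻¹ * a * x i)) * LinearMap.trace K V (ρ.asAlgebraHom (idem E)) := by
    intro a
    have : ρ a = ∑ i, ρ a * ρ.asAlgebraHom (cidem E (x i)) := by
      rw [← Finset.mul_sum, ← map_sum, hone, mul_one]
    conv_lhs => rw [this]
    rw [map_sum, Finset.sum_mul]
    exact Finset.sum_congr rfl fun i _ => htr _ _
  have : Module.Finite K V := Module.finite_of_finrank_pos (by rw [hdim]; norm_num)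
  have h8 := hsum 1
  rw [map_one, LinearMap.trace_one, hdim] at h8
  simp only [mul_one, inv_mul_cancel, hE.one] at h8
  have ht1 : LinearMap.trace K V (ρ.asAlgebraHom (idem E)) = 1 := by
    have h8' : (8 : K) * 1 = 8 * LinearMap.trace K V (ρ.asAlgebraHom (idem E)) := by
      simpa using h8
    exact (mul_left_cancel₀ (by norm_num) h8').symm
  rw [hsum, ht1, mul_one]

end

theorem idem_ne_zero {G K V : Type} [Group G] [Fintype G] [Field K] [Algebra ℚ K]
    [IsCyclotomicExtension {3} ℚ K] [CharZero K] {ζ : K} (hζ : IsPrimitiveRoot ζ 3)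
    {t s w : G} {E : G → K}
    [AddCommGroup V] [Module K V] {ρ : Representation K G V}
    (hE : IsE (Subgroup.closure {t, s}) E) (hEt : E t = ζ ^ 2) (hEs : E s = 1) (hirr : Irr ρ)
    (hdim : Module.finrank K V = 8) (hc : Nat.card (Subgroup.closure {t, s}) = 21)
    (x : Fin 8 → G)
    (hcov : ∀ g, ∃ k, (x k)⁻¹ * g ∈ Subgroup.closure {t, s})
    (hdis : ∀ i j, (x i)⁻¹ * x j ∈ Subgroup.closure {t, s} → i = j)
    (t3 : t ^ 3 = 1) (s7 : s ^ 7 = 1)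
    (st : s * t = t * s ^ 4) (w2 : w * w = 1) (wt : w * t * w = t⁻¹) :
    ρ.asAlgebraHom (idem E) ≠ 0 := by
  intro h0
  have htH : t ∈ Subgroup.closure {t, s} := Subgroup.subset_closure (by simp)
  have hsH : s ∈ Subgroup.closure {t, s} := Subgroup.subset_closure (by simp)
  let E1 : G → K := fun g => if g ∈ Subgroup.closure {t, s} then 1 else 0
  have hE1 : IsE (Subgroup.closure {t, s}) E1 := by
    refine ⟨by simp [E1, one_mem], fun g hg => by simp [E1, hg], fun h g hh => ?_,
      fun g h hh => ?_⟩
    · simp only [E1, hh, if_true, one_mul, Subgroup.mul_mem_cancel_left _ hh]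
    · simp only [E1, hh, if_true, mul_one, Subgroup.mul_mem_cancel_right _ hh]
  have h1 := triv_zero hE1 (fun h hh => by simp [E1, hh]) hirr hdim hc x hcov hdis
  let χ : G → K := fun g => LinearMap.trace K V (ρ g)
  have hconj : ∀ a y : G, χ (y * a * y⁻¹) = χ a := by
    intro a y
    simp only [χ, map_mul]
    rw [LinearMap.trace_mul_comm, ← mul_assoc, ← map_mul, inv_mul_cancel, map_one, one_mul]
  have main : ∀ F : G → K, IsE (Subgroup.closure {t, s}) F → ρ.asAlgebraHom (idem F) = 0 →
      ∑ a ∈ Finset.range 3, ∑ b ∈ Finset.range 7, F (t ^ a * s ^ b)⁻¹ * χ (t ^ a * s ^ b) = 0 := by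
    intro F hF hF0
    have := trace_idem (ρ := ρ) F
    rw [hF0, map_zero] at this
    have h3 : ∑ g, F g⁻¹ * χ g = 0 := by
      have h21 : (21 : K)⁻¹ ≠ 0 := by norm_num
      exact (mul_eq_zero.1 this.symm).resolve_left h21
    rwa [H_sum t s t3 s7 st hc (fun g => F g⁻¹ * χ g) (fun g hg => by
      rw [hF.off g⁻¹ (fun h => hg (by simpa using inv_mem h)), zero_mul])] at h3
  have hsc : SemiconjBy t (s ^ 4) s := st.symm
  have hsinv : ∀ n : ℕ, (s ^ n)⁻¹ = s ^ (6 * n) := by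
    intro n
    rw [inv_eq_iff_mul_eq_one, ← pow_add, show n + 6 * n = 7 * n by ring, pow_mul, s7, one_pow]
  have hs7 : ∀ n m : ℕ, s ^ (7 * n + m) = s ^ m := by
    intro n m
    rw [pow_add, pow_mul, s7, one_pow, one_mul]
  have c1 : ∀ b : ℕ, χ (t * s ^ b) = χ t := by
    intro b
    rw [← hconj t (s ^ (5 * b)), hsinv]
    have h := (hsc.pow_right (5 * b)).eq
    rw [← h, ← pow_mul, mul_assoc, ← pow_add]
    congr 2
    rw [show 4 * (5 * b) + 6 * (5 * b) = 7 * (7 * b) + b by ring, hs7]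
  have c2' : ∀ b : ℕ, χ (t ^ 2 * s ^ b) = χ (t ^ 2) := by
    intro b
    rw [← hconj (t ^ 2) (s ^ b), hsinv]
    have h := (hsc.pow_right b).eq
    have h2 := (hsc.pow_right (4 * b)).eq
    rw [← pow_mul] at h h2
    have h3 : s ^ b * t ^ 2 = t ^ 2 * s ^ (16 * b) := by
      rw [pow_two, ← mul_assoc, ← h, mul_assoc, ← h2, ← mul_assoc]
      congr 2; ring
    rw [h3, mul_assoc, ← pow_add]
    congr 2
    rw [show 16 * b + 6 * b = 7 * (3 * b) + b by ring, hs7]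
  have c2 : ∀ b : ℕ, χ (t ^ 2 * s ^ b) = χ t := by
    intro b
    rw [c2', ← hconj t w, inv_eq_of_mul_eq_one_left w2, wt]
    congr 1
    symm
    rw [inv_eq_iff_mul_eq_one, ← pow_succ', t3]
  have hFval : ∀ F : G → K, IsE (Subgroup.closure {t, s}) F → F s = 1 → ∀ a b : ℕ,
      F (t ^ a * s ^ b)⁻¹ = (F t ^ 2) ^ a := by
    intro F hF hFs a b
    have hp : ∀ y ∈ Subgroup.closure {t, s}, ∀ n : ℕ, F (y ^ n) = F y ^ n := by
      intro y hy n
      induction n with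
      | zero => simp [hF.one]
      | succ n ih => rw [pow_succ, hF.mul_right _ _ hy, ih, pow_succ]
    have tinv : (t ^ a)⁻¹ = t ^ (2 * a) := by
      rw [inv_eq_iff_mul_eq_one, ← pow_add, show a + 2 * a = 3 * a by ring, pow_mul, t3, one_pow]
    rw [mul_inv_rev, hsinv, tinv, hF.mul_left _ _ (pow_mem hsH _), hp _ hsH, hp _ htH, hFs,
      one_pow, one_mul, pow_mul]
  have m1 := main E1 hE1 h1
  have m2 := main E hE h0
  have hE1t : E1 t = 1 := by simp [E1, htH]
  have hE1s : E1 s = 1 := by simp [E1, hsH]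
  simp only [hFval E1 hE1 hE1s, hFval E hE hEs, hE1t, hEt] at m1 m2
  rw [Finset.sum_range_succ, Finset.sum_range_succ, Finset.sum_range_one] at m1 m2
  simp only [c1, c2, one_pow, one_mul, pow_zero, pow_one, Finset.sum_const, Finset.card_range,
    nsmul_eq_mul] at m1 m2
  set S := ∑ b ∈ Finset.range 7, χ (s ^ b) with hS
  have hz3 : ζ ^ 3 = 1 := hζ.pow_eq_one
  have hz : 1 + ζ + ζ ^ 2 = 0 := by
    have := hζ.geom_sum_eq_zero (by norm_num)
    simpa [Finset.sum_range_succ] using this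
  have hS0 : S = 0 := by
    have e4 : (ζ ^ 2) ^ 2 = ζ := by rw [show (ζ ^ 2) ^ 2 = ζ ^ 3 * ζ by ring, hz3, one_mul]
    rw [e4] at m2
    push_cast at m1 m2
    have hT : 21 * χ t = 0 := by linear_combination m1 - m2 + 7 * χ t * hz
    have hT0 : χ t = 0 := by
      rcases mul_eq_zero.1 hT with h | h
      · norm_num at h
      · exact h
    rw [hT0] at m1
    linear_combination m1
  set Q : Module.End K V := ∑ b ∈ Finset.range 7, ρ s ^ b with hQ
  have y7 : ρ s ^ 7 = 1 := by rw [← map_pow, s7, map_one]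
  have hyQ : ρ s * Q = Q := by
    have := mul_geom_sum (ρ s) 7
    rw [y7, sub_self, sub_mul, one_mul, sub_eq_zero] at this
    exact this
  have hyQn : ∀ n : ℕ, ρ s ^ n * Q = Q := by
    intro n
    induction n with
    | zero => simp
    | succ n ih => rw [pow_succ, mul_assoc, hyQ, ih]
  have hQQ : Q * Q = (7 : K) • Q := by
    conv_lhs => lhs; rw [hQ]
    rw [Finset.sum_mul]
    simp only [hyQn, Finset.sum_const, Finset.card_range]
    rw [← Nat.cast_smul_eq_nsmul K]; norm_num
  have hid : IsIdempotentElem ((7 : K)⁻¹ • Q) := by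
    unfold IsIdempotentElem
    rw [smul_mul_smul_comm, hQQ, smul_smul]
    congr 1
    field_simp
  have htrQ : LinearMap.trace K V ((7 : K)⁻¹ • Q) = 0 := by
    rw [map_smul, hQ, map_sum]
    have : ∑ b ∈ Finset.range 7, LinearMap.trace K V (ρ s ^ b) = S := by
      rw [hS]
      refine Finset.sum_congr rfl fun b _ => ?_
      simp only [χ, map_pow]
    rw [this, hS0, smul_zero]
  have : Module.Finite K V := Module.finite_of_finrank_pos (by rw [hdim]; norm_num)
  have hQ0 := LinearMap.IsIdempotentElem.eq_zero_of_trace_eq_zero hid htrQ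
  have hQ0' : Q = 0 := (smul_eq_zero.1 hQ0).resolve_left (by norm_num)
  exact no_seven hdim (ρ s) hQ0'

/-- Extension by zero of a linear character. -/
noncomputable def extE {G K : Type} [Group G] [Field K] {H : Subgroup G} (ψ : H →* K) (g : G) : K :=
  if hg : g ∈ H then ψ ⟨g, hg⟩ else 0

theorem extE_mem {G K : Type} [Group G] [Field K] {H : Subgroup G} (ψ : H →* K) {g : G}
    (hg : g ∈ H) : extE ψ g = ψ ⟨g, hg⟩ := dif_pos hg

theorem extE_not_mem {G K : Type} [Group G] [Field K] {H : Subgroup G} (ψ : H →* K) {g : G}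
    (hg : g ∉ H) : extE ψ g = 0 := dif_neg hg

theorem isE_extE {G K : Type} [Group G] [Field K] {H : Subgroup G} (ψ : H →* K) :
    IsE H (extE ψ) := by
  refine ⟨?_, fun g hg => extE_not_mem ψ hg, fun h g hh => ?_, fun g h hh => ?_⟩
  · rw [extE_mem ψ (one_mem H)]; exact map_one ψ
  · by_cases hg : g ∈ H
    · rw [extE_mem ψ hg, extE_mem ψ hh, extE_mem ψ (mul_mem hh hg), ← map_mul]; rfl
    · rw [extE_not_mem ψ hg, mul_zero, extE_not_mem]
      rwa [Subgroup.mul_mem_cancel_left _ hh]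
  · by_cases hg : g ∈ H
    · rw [extE_mem ψ hg, extE_mem ψ hh, extE_mem ψ (mul_mem hg hh), ← map_mul]; rfl
    · rw [extE_not_mem ψ hg, zero_mul, extE_not_mem]
      rwa [Subgroup.mul_mem_cancel_right _ hh]

theorem subIdem_coeff {G K : Type} [Group G] [Fintype G] [Field K] {H : Subgroup G} (ψ : H →* K)
    (hc : Nat.card H = 21) (g : G) :
    (subIdem H ψ).coeff g = (21 : K)⁻¹ * extE ψ g⁻¹ := by
  unfold subIdem
  have h21 : Fintype.card H = 21 := by rw [← hc, Nat.card_eq_fintype_card]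
  rw [h21, MonoidAlgebra.coeff_smul_apply, smul_eq_mul, MonoidAlgebra.coeff_sum,
    Finsupp.finsetSum_apply]
  congr 1
  by_cases hg : g ∈ H
  · rw [Finset.sum_eq_single ⟨g, hg⟩]
    · rw [extE_mem ψ (inv_mem hg)]
      rw [MonoidAlgebra.coeff_single, Finsupp.single_eq_same]
      rfl
    · intro b _ hb
      rw [MonoidAlgebra.coeff_single_apply, if_neg]
      intro h
      exact hb (Subtype.ext h)
    · simp
  · rw [extE_not_mem ψ (fun h => hg (by simpa using inv_mem h))]
    apply Finset.sum_eq_zero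
    intro b _
    rw [MonoidAlgebra.coeff_single_apply, if_neg]
    rintro rfl
    exact hg b.2

theorem cenIdem_coeff {G K : Type} [Group G] [Fintype G] [Field K] (χ : G → K) (d : K) (g : G) :
    (cenIdem χ d).coeff g = d / (Fintype.card G : K) * χ g⁻¹ := by
  unfold cenIdem
  rw [MonoidAlgebra.coeff_smul_apply, smul_eq_mul, MonoidAlgebra.coeff_sum,
    Finsupp.finsetSum_apply]
  congr 1
  rw [Finset.sum_eq_single g]
  · simp
  · intro b _ hb
    simp [hb]
  · simp

theorem IsE.pow {G K : Type} [Group G] [Field K] {H : Subgroup G} {F : G → K} (hF : IsE H F)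
    {y : G} (hy : y ∈ H) (n : ℕ) : F (y ^ n) = F y ^ n := by
  induction n with
  | zero => simp [hF.one]
  | succ n ih => rw [pow_succ, hF.mul_right _ _ hy, ih, pow_succ]

theorem IsE.s_one {G K : Type} [Group G] [Field K] {t s : G} {F : G → K}
    (hF : IsE (Subgroup.closure {t, s}) F) (s7 : s ^ 7 = 1) (st : s * t = t * s ^ 4) :
    F s = 1 := by
  have htH : t ∈ Subgroup.closure {t, s} := Subgroup.subset_closure (by simp)
  have hsH : s ∈ Subgroup.closure {t, s} := Subgroup.subset_closure (by simp)
  have hs0 : F s ≠ 0 := fun h => by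
    have := hF.inv_mul hsH
    rw [h, mul_zero] at this
    exact zero_ne_one this
  have ht0 : F t ≠ 0 := fun h => by
    have := hF.inv_mul htH
    rw [h, mul_zero] at this
    exact zero_ne_one this
  have h1 := congrArg F st
  rw [hF.mul_left _ _ hsH, hF.mul_left _ _ htH, hF.pow hsH] at h1
  have h3 : F s ^ 3 = 1 := by
    have : (F t * F s) * F s ^ 3 = (F t * F s) * 1 := by linear_combination -h1
    exact mul_left_cancel₀ (mul_ne_zero ht0 hs0) this
  have h7 : F s ^ 7 = 1 := by rw [← hF.pow hsH, s7, hF.one]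
  calc F s = F s ^ 7 * 1 := by
        rw [show F s ^ 7 * 1 = (F s ^ 3) * (F s ^ 3) * F s by ring, h3]; ring
    _ = 1 := by rw [h7, mul_one]

theorem IsE.unique {G K : Type} [Group G] [Field K] {t s : G} {E F : G → K}
    (hE : IsE (Subgroup.closure {t, s}) E) (hF : IsE (Subgroup.closure {t, s}) F)
    (t3 : t ^ 3 = 1) (s7 : s ^ 7 = 1) (st : s * t = t * s ^ 4) (h : E t = F t) (g : G) :
    E g = F g := by
  have htH : t ∈ Subgroup.closure {t, s} := Subgroup.subset_closure (by simp)
  have hsH : s ∈ Subgroup.closure {t, s} := Subgroup.subset_closure (by simp)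
  by_cases hg : g ∈ Subgroup.closure {t, s}
  · obtain ⟨a, -, b, -, rfl⟩ := H_form t s t3 s7 st g hg
    rw [hE.mul_left _ _ (pow_mem htH _), hF.mul_left _ _ (pow_mem htH _), hE.pow htH, hF.pow htH,
      hE.pow hsH, hF.pow hsH, hE.s_one s7 st, hF.s_one s7 st, h]
  · rw [hE.off _ hg, hF.off _ hg]

theorem closure_ind {P : Type} [Group P] {G : Subgroup P} {S : Set P}
    (hG : G = Subgroup.closure S) (M : G → Prop) (h1 : M 1)
    (hS : ∀ a : G, (a : P) ∈ S → ∀ y, M y → M (a * y) ∧ M (a⁻¹ * y)) (g : G) : M g := by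
  subst hG
  obtain ⟨g, hg⟩ := g
  induction hg using Subgroup.closure_induction_left with
  | one => exact h1
  | mul_left x hx y hy ih => exact (hS ⟨x, Subgroup.subset_closure hx⟩ hx _ ih).1
  | inv_mul_cancel x hx y hy ih => exact (hS ⟨x, Subgroup.subset_closure hx⟩ hx _ ih).2

theorem final_core {K G : Type} [Field K] [Algebra ℚ K] [IsCyclotomicExtension {3} ℚ K]
    {ζ : K} (hζ : IsPrimitiveRoot ζ 3) [Group G] [Fintype G] (t s : Fin 8 → G)
    (hcard : ∀ i, Nat.card (Subgroup.closure {t i, s i} : Subgroup G) = 21)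
    (hinj : Function.Injective (fun i => (Subgroup.closure {t i, s i} : Subgroup G)))
    (η : ∀ i, (Subgroup.closure {t i, s i} : Subgroup G) →* K)
    (hη : ∀ i, η i ⟨t i, Subgroup.subset_closure (Set.mem_insert _ _)⟩ = ζ ^ 2)
    (V : FDRep K G) (hV : CategoryTheory.Simple V) (hdim : Module.finrank K V = 8)
    (w : G) (x : Fin 8 → G) (x0 : x 0 = 1)
    (t3 : t 0 ^ 3 = 1) (s7 : s 0 ^ 7 = 1) (st : s 0 * t 0 = t 0 * s 0 ^ 4)
    (w2 : w * w = 1) (wt : w * t 0 * w = (t 0)⁻¹)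
    (hM : ∀ g, inM (Subgroup.closure {t 0, s 0}) w g)
    (hxt : ∀ i, x i * t 0 * (x i)⁻¹ = t i)
    (hxs : ∀ i, x i * s 0 * (x i)⁻¹ ∈ Subgroup.closure {t i, s i})
    (hxw : ∀ b < 7, ∃ k, (x k)⁻¹ * ((s 0 ^ b)⁻¹ * w) ∈ Subgroup.closure {t 0, s 0}) :
    cenIdem V.character 8 = ∑ i, subIdem (Subgroup.closure {t i, s i}) (η i) ∧
    ∀ i j, subIdem (Subgroup.closure {t i, s i}) (η i) *
        subIdem (Subgroup.closure {t j, s j}) (η j) =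
      if i = j then subIdem (Subgroup.closure {t i, s i}) (η i) else 0 := by
  have : CharZero K := algebraRat.charZero K
  have htH : t 0 ∈ Subgroup.closure {t 0, s 0} := Subgroup.subset_closure (by simp)
  -- the conjugates
  have hconj : ∀ i, Subgroup.map (MulAut.conj (x i)).toMonoidHom (Subgroup.closure {t 0, s 0}) =
      Subgroup.closure {t i, s i} := by
    intro i
    apply Subgroup.eq_of_le_of_card_ge
    · rw [Subgroup.map_le_iff_le_comap, Subgroup.closure_le]
      rintro y (rfl | rfl)
      · change x i * t 0 * (x i)⁻¹ ∈ Subgroup.closure {t i, s i}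
        rw [hxt]; exact Subgroup.subset_closure (by simp)
      · exact hxs i
    · rw [hcard, Subgroup.card_map_of_injective (MulAut.conj (x i)).injective, hcard]
  have hmem : ∀ i g, x i * g * (x i)⁻¹ ∈ Subgroup.closure {t i, s i} ↔
      g ∈ Subgroup.closure {t 0, s 0} := by
    intro i g
    rw [← hconj i]
    exact Subgroup.mem_map_iff_mem (f := (MulAut.conj (x i)).toMonoidHom)
      (MulAut.conj (x i)).injective
  have hdis : ∀ i j, (x i)⁻¹ * x j ∈ Subgroup.closure {t 0, s 0} → i = j := by
    intro i j h
    apply hinj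
    simp only
    rw [← hconj i, ← hconj j]
    have hji : x j = x i * ((x i)⁻¹ * x j) := by group
    generalize (x i)⁻¹ * x j = h0 at h hji
    rw [hji]
    ext g
    have e1 : ∀ y : G, g ∈ Subgroup.map (MulAut.conj y).toMonoidHom (Subgroup.closure {t 0, s 0}) ↔
        y⁻¹ * g * y ∈ Subgroup.closure {t 0, s 0} := by
      intro y
      constructor
      · rintro ⟨z, hz, rfl⟩
        have e : y⁻¹ * ((MulAut.conj y).toMonoidHom z) * y = z := by
          change y⁻¹ * (y * z * y⁻¹) * y = z
          group
        rw [e]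
        exact hz
      · intro h
        refine ⟨_, h, ?_⟩
        change y * (y⁻¹ * g * y) * y⁻¹ = g
        group
    rw [e1, e1]
    have e2 : (x i * h0)⁻¹ * g * (x i * h0) = h0⁻¹ * ((x i)⁻¹ * g * x i) * h0 := by group
    rw [e2, Subgroup.mul_mem_cancel_right _ h, Subgroup.mul_mem_cancel_left _ (inv_mem h)]
  have hcov : ∀ g, ∃ k, (x k)⁻¹ * g ∈ Subgroup.closure {t 0, s 0} := by
    intro g
    rcases hM g with h | ⟨h, hh, h', hh', rfl⟩
    · exact ⟨0, by simpa [x0] using h⟩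
    · obtain ⟨a, ha, b, hb, hab⟩ := H_form _ _ t3 s7 st _ (inv_mem hh)
      have hh2 : h = (s 0 ^ b)⁻¹ * (t 0 ^ a)⁻¹ := by
        rw [← mul_inv_rev, ← hab, inv_inv]
      obtain ⟨k, hk⟩ := hxw b hb
      refine ⟨k, ?_⟩
      have : (x k)⁻¹ * (h * w * h') = ((x k)⁻¹ * ((s 0 ^ b)⁻¹ * w)) * (t 0 ^ a * h') := by
        rw [hh2, mul_assoc _ _ w, ← w_pow w2 wt]; group
      rw [this]
      exact mul_mem hk (mul_mem (pow_mem htH _) hh')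
  have hcardG : Fintype.card G = 168 := by
    have hb : Function.Bijective (fun p : Fin 8 × (Subgroup.closure {t 0, s 0} : Subgroup G) =>
        x p.1 * (p.2 : G)) := by
      constructor
      · rintro ⟨i, h⟩ ⟨j, h'⟩ he
        simp only at he
        have hij : i = j := by
          apply hdis
          have : (x i)⁻¹ * x j = (h : G) * (h' : G)⁻¹ := by
            rw [inv_mul_eq_iff_eq_mul, ← mul_assoc, he, mul_inv_cancel_right]
          rw [this]
          exact mul_mem h.2 (inv_mem h'.2)
        subst hij
        have := mul_left_cancel he
        rw [Subtype.ext this]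
      · intro g
        obtain ⟨k, hk⟩ := hcov g
        exact ⟨(k, ⟨_, hk⟩), by simp⟩
    have := Nat.card_congr (Equiv.ofBijective _ hb)
    rw [Nat.card_prod, hcard, Nat.card_eq_fintype_card, Nat.card_eq_fintype_card,
      Fintype.card_fin] at this
    omega
  have hE := isE_extE (η 0)
  have hEt : extE (η 0) (t 0) = ζ ^ 2 := by rw [extE_mem _ htH]; exact hη 0
  have hEs : extE (η 0) (s 0) = 1 := hE.s_one s7 st
  have hEi : ∀ i g, extE (η i) g = extE (η 0) ((x i)⁻¹ * g * x i) := by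
    intro i
    have hF : IsE (Subgroup.closure {t 0, s 0}) (fun g => extE (η i) (x i * g * (x i)⁻¹)) := by
      have hi := isE_extE (η i)
      have hm : ∀ a b : G, x i * (a * b) * (x i)⁻¹ =
          (x i * a * (x i)⁻¹) * (x i * b * (x i)⁻¹) := by intro a b; group
      refine ⟨?_, ?_, ?_, ?_⟩
      · simp only [mul_one, mul_inv_cancel, hi.one]
      · intro g hg
        exact hi.off _ (fun h => hg ((hmem i g).1 h))
      · intro h g hh
        simp only [hm]
        exact hi.mul_left _ _ ((hmem i h).2 hh)
      · intro g h hh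
        simp only [hm]
        exact hi.mul_right _ _ ((hmem i h).2 hh)
    intro g
    have := hF.unique hE t3 s7 st (by
      simp only [hxt]
      rw [hEt, extE_mem (η i) (Subgroup.subset_closure (by simp))]
      exact hη i) ((x i)⁻¹ * g * x i)
    rw [← this]
    congr 1
    group
  have hsub : ∀ i, subIdem (Subgroup.closure {t i, s i}) (η i) = cidem (extE (η 0)) (x i) := by
    intro i
    ext g
    rw [subIdem_coeff _ (hcard i), cidem_apply, hEi]
  have hne : extE (η 0) (t 0) ≠ extE (η 0) (t 0)⁻¹ := by
    have h1 := hE.inv_mul htH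
    intro h
    rw [← h, hEt] at h1
    have hz3 := hζ.pow_eq_one
    have hz1 : ζ = 1 := by linear_combination h1 - ζ * hz3
    exact hζ.ne_one (by norm_num) hz1
  have horth : ∀ g, g ∉ Subgroup.closure {t 0, s 0} →
      idem (extE (η 0)) * MonoidAlgebra.single g 1 * idem (extE (η 0)) = 0 := by
    refine orth_of_w hE htH hM ?_ hne
    rw [← wt, ← mul_assoc, ← mul_assoc, w2, one_mul]
  have hirr : Irr V.ρ := fun p hp v hv hvp => simple_sub V hV p hp v hv hvp
  have hnz := idem_ne_zero (ρ := V.ρ) hζ hE hEt hEs hirr hdim (hcard 0) x hcov hdis t3 s7 st w2 wt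
  simp only [hsub]
  refine ⟨?_, cidem_mul_cidem hE (hcard 0) horth x hdis⟩
  ext g
  rw [cenIdem_coeff, MonoidAlgebra.coeff_sum, Finsupp.finsetSum_apply]
  simp only [cidem_apply]
  rw [← Finset.mul_sum, hcardG]
  have := char_formula (ρ := V.ρ) hE hirr hdim (hcard 0) x hcov hdis horth hnz g⁻¹
  rw [← this]
  change _ * LinearMap.trace K V (V.ρ g⁻¹) = _
  congr 1
  norm_num

/-- Exponents for the conjugating elements. -/
def ccExp : Fin 8 → ℕ := ![0, 0, 1, 2, 6, 4, 5, 3]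

/-- Exponents for the conjugating elements. -/
def ddExp : Fin 8 → ℕ := ![0, 3, 0, 4, 6, 5, 6, 1]

/-- Exponents for the conjugated order-7 elements. -/
def mmExp : Fin 8 → ℕ := ![1, 2, 1, 2, 2, 4, 2, 2]

theorem stmt6
    (K : Type) [Field K] [Algebra ℚ K] [IsCyclotomicExtension {3} ℚ K]
    (ζ : K) (hζ : IsPrimitiveRoot ζ 3)
    (G : Subgroup (Equiv.Perm (Fin 9)))
    (hG : G = Subgroup.closure
      {c[(3 : Fin 9), 6, 7] * c[(4 : Fin 9), 5, 8], c[(1 : Fin 9), 8, 2] * c[(4 : Fin 9), 5, 6]})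
    -- the order-3 generators t_i and order-7 generators s_i of H₁, …, H₈
    (t s : Fin 8 → G)
    (ht : (fun i => (t i : Equiv.Perm (Fin 9))) = ![
      c[(1 : Fin 9), 4, 2] * c[(5 : Fin 9), 8, 7],
      c[(1 : Fin 9), 4, 7] * c[(2 : Fin 9), 8, 6],
      c[(1 : Fin 9), 5, 2] * c[(3 : Fin 9), 8, 4],
      c[(1 : Fin 9), 7, 4] * c[(2 : Fin 9), 6, 8],
      c[(1 : Fin 9), 8, 5] * c[(2 : Fin 9), 7, 6],
      c[(1 : Fin 9), 5, 4] * c[(2 : Fin 9), 6, 3],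
      c[(1 : Fin 9), 7, 5] * c[(3 : Fin 9), 6, 8],
      c[(2 : Fin 9), 3, 4] * c[(6 : Fin 9), 8, 7]])
    (hs : (fun i => (s i : Equiv.Perm (Fin 9))) = ![
      c[(1 : Fin 9), 8, 2, 4, 3, 7, 5],
      c[(1 : Fin 9), 7, 5, 6, 2, 4, 8],
      c[(1 : Fin 9), 4, 2, 5, 6, 3, 8],
      c[(1 : Fin 9), 8, 6, 3, 7, 4, 2],
      c[(1 : Fin 9), 5, 3, 7, 6, 8, 2],
      c[(1 : Fin 9), 4, 7, 6, 3, 5, 2],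
      c[(1 : Fin 9), 8, 5, 7, 4, 3, 6],
      c[(2 : Fin 9), 6, 7, 5, 3, 4, 8]])
    -- H i := ⟨t i, s i⟩; these are the eight conjugates of H₁ in G
    (hcard : ∀ i, Nat.card (Subgroup.closure {t i, s i} : Subgroup G) = 21)
    (hconj : ∀ i, ∃ g : G,
      Subgroup.closure {t i, s i} = conjSub g (Subgroup.closure {t 0, s 0}))
    (hinj : Function.Injective (fun i => (Subgroup.closure {t i, s i} : Subgroup G)))
    (hcompl : ∀ T : Subgroup G, (∃ g : G, T = conjSub g (Subgroup.closure {t 0, s 0})) →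
      ∃ i, T = Subgroup.closure {t i, s i})
    -- η i : the degree-1 character of H i with η i (t i) = ζ₃²
    (η : ∀ i, (Subgroup.closure {t i, s i} : Subgroup G) →* K)
    (hη : ∀ i, η i ⟨t i, Subgroup.subset_closure (Set.mem_insert _ _)⟩ = ζ ^ 2)
    -- the irreducible character of G of degree 8
    (V : FDRep K G) (hV : CategoryTheory.Simple V) (hdim : Module.finrank K V = 8) :
    cenIdem V.character 8 = ∑ i, subIdem (Subgroup.closure {t i, s i}) (η i) ∧
    ∀ i j, subIdem (Subgroup.closure {t i, s i}) (η i) *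
        subIdem (Subgroup.closure {t j, s j}) (η j) =
      if i = j then subIdem (Subgroup.closure {t i, s i}) (η i) else 0 := by
  have ht0 : (t 0 : Equiv.Perm (Fin 9)) = c[(1 : Fin 9), 4, 2] * c[(5 : Fin 9), 8, 7] :=
    congrFun ht 0
  have ht3 : (t 3 : Equiv.Perm (Fin 9)) = c[(1 : Fin 9), 7, 4] * c[(2 : Fin 9), 6, 8] :=
    congrFun ht 3
  have ht5 : (t 5 : Equiv.Perm (Fin 9)) = c[(1 : Fin 9), 5, 4] * c[(2 : Fin 9), 6, 3] :=
    congrFun ht 5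
  have hs0 : (s 0 : Equiv.Perm (Fin 9)) = c[(1 : Fin 9), 8, 2, 4, 3, 7, 5] := congrFun hs 0
  obtain ⟨w, hw⟩ : ∃ w : G, w = t 3 * t 5 := ⟨_, rfl⟩
  have hw0 : (w : Equiv.Perm (Fin 9)) = c[(1 : Fin 9), 7, 4] * c[(2 : Fin 9), 6, 8] *
      (c[(1 : Fin 9), 5, 4] * c[(2 : Fin 9), 6, 3]) := by
    rw [hw, Subgroup.coe_mul, ht3, ht5]
  have htH : t 0 ∈ Subgroup.closure {t 0, s 0} := Subgroup.subset_closure (by simp)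
  have hsH : s 0 ∈ Subgroup.closure {t 0, s 0} := Subgroup.subset_closure (by simp)
  have t3 : t 0 ^ 3 = 1 := Subtype.ext (by
    simp only [Subgroup.coe_pow, Subgroup.coe_one, ht0]
    ext z; revert z; decide +kernel)
  have s7 : s 0 ^ 7 = 1 := Subtype.ext (by
    simp only [Subgroup.coe_pow, Subgroup.coe_one, hs0]
    ext z; revert z; decide +kernel)
  have st : s 0 * t 0 = t 0 * s 0 ^ 4 := Subtype.ext (by
    simp only [Subgroup.coe_pow, Subgroup.coe_mul, hs0, ht0]
    ext z; revert z; decide +kernel)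
  have w2 : w * w = 1 := Subtype.ext (by
    simp only [Subgroup.coe_mul, Subgroup.coe_one, hw0]
    ext z; revert z; decide +kernel)
  have wt : w * t 0 * w = (t 0)⁻¹ := Subtype.ext (by
    simp only [Subgroup.coe_mul, Subgroup.coe_inv, hw0, ht0]
    ext z; revert z; decide +kernel)
  have winv : w⁻¹ = w := inv_eq_of_mul_eq_one_left w2
  -- the relations `w s^b w ∈ H ∪ H w H`
  have hwsw : ∀ b < 7, inM (Subgroup.closure {t 0, s 0}) w (w * s 0 ^ b * w) := by
    have aux : ∀ b c a d : ℕ, w * s 0 ^ b * w = s 0 ^ c * w * (t 0 ^ a * s 0 ^ d) →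
        inM (Subgroup.closure {t 0, s 0}) w (w * s 0 ^ b * w) := fun b c a d h =>
      Or.inr ⟨_, pow_mem hsH c, _, mul_mem (pow_mem htH a) (pow_mem hsH d), h⟩
    intro b hb
    interval_cases b
    · exact Or.inl (by rw [pow_zero, mul_one, w2]; exact one_mem _)
    · refine aux 1 6 0 6 (Subtype.ext ?_)
      simp only [Subgroup.coe_mul, Subgroup.coe_pow, hw0, ht0, hs0]
      ext z; revert z; decide +kernel
    · refine aux 2 3 2 3 (Subtype.ext ?_)
      simp only [Subgroup.coe_mul, Subgroup.coe_pow, hw0, ht0, hs0]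
      ext z; revert z; decide +kernel
    · refine aux 3 2 1 2 (Subtype.ext ?_)
      simp only [Subgroup.coe_mul, Subgroup.coe_pow, hw0, ht0, hs0]
      ext z; revert z; decide +kernel
    · refine aux 4 5 1 5 (Subtype.ext ?_)
      simp only [Subgroup.coe_mul, Subgroup.coe_pow, hw0, ht0, hs0]
      ext z; revert z; decide +kernel
    · refine aux 5 4 2 4 (Subtype.ext ?_)
      simp only [Subgroup.coe_mul, Subgroup.coe_pow, hw0, ht0, hs0]
      ext z; revert z; decide +kernel
    · refine aux 6 1 0 1 (Subtype.ext ?_)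
      simp only [Subgroup.coe_mul, Subgroup.coe_pow, hw0, ht0, hs0]
      ext z; revert z; decide +kernel
  have hMw : ∀ y, inM (Subgroup.closure {t 0, s 0}) w y →
      inM (Subgroup.closure {t 0, s 0}) w (w * y) := fun y hy => inM_w t3 s7 st w2 wt hwsw hy
  have hM : ∀ g, inM (Subgroup.closure {t 0, s 0}) w g := by
    refine closure_ind hG _ (Or.inl (one_mem _)) ?_
    rintro a (ha | ha)
    · have ha' : a = s 0 * w := Subtype.ext (by
        rw [ha]
        simp only [Subgroup.coe_mul, hw0, hs0]
        ext z; revert z; decide +kernel)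
      intro y hy
      rw [ha', mul_inv_rev, winv, mul_assoc, mul_assoc]
      exact ⟨inM_H hsH (hMw _ hy), hMw _ (inM_H (inv_mem hsH) hy)⟩
    · have ha' : a = s 0 ^ 6 * (w * (t 0 ^ 2 * s 0 ^ 5)) := Subtype.ext (by
        rw [ha]
        simp only [Subgroup.coe_mul, Subgroup.coe_pow, hw0, hs0, ht0]
        ext z; revert z; decide +kernel)
      intro y hy
      have h1 : t 0 ^ 2 * s 0 ^ 5 ∈ Subgroup.closure {t 0, s 0} :=
        mul_mem (pow_mem htH _) (pow_mem hsH _)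
      have h2 := pow_mem hsH 6
      have e1 : a * y = s 0 ^ 6 * (w * ((t 0 ^ 2 * s 0 ^ 5) * y)) := by
        rw [ha']; simp only [mul_assoc]
      have e2 : a⁻¹ * y = (t 0 ^ 2 * s 0 ^ 5)⁻¹ * (w * ((s 0 ^ 6)⁻¹ * y)) := by
        rw [ha', mul_inv_rev, mul_inv_rev, winv, mul_assoc, mul_assoc]
      rw [e1, e2]
      exact ⟨inM_H h2 (hMw _ (inM_H h1 hy)), inM_H (inv_mem h1) (hMw _ (inM_H (inv_mem h2) hy))⟩
  -- the conjugating elements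
  let x : Fin 8 → G := fun i => if i = 0 then 1 else s 0 ^ ccExp i * w * s 0 ^ ddExp i
  have hxv : ∀ i, (x i : Equiv.Perm (Fin 9)) = if i = 0 then 1 else
      c[(1 : Fin 9), 8, 2, 4, 3, 7, 5] ^ ccExp i * (c[(1 : Fin 9), 7, 4] * c[(2 : Fin 9), 6, 8] *
      (c[(1 : Fin 9), 5, 4] * c[(2 : Fin 9), 6, 3])) *
        c[(1 : Fin 9), 8, 2, 4, 3, 7, 5] ^ ddExp i := by
    intro i
    simp only [x]
    split_ifs
    · rfl
    · simp only [Subgroup.coe_mul, Subgroup.coe_pow, hw0, hs0]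
  have htv := fun i => congrFun ht i
  have hsv := fun i => congrFun hs i
  have hxt : ∀ i, x i * t 0 = t i * x i := fun i => Subtype.ext (by
    simp only [Subgroup.coe_mul, hxv, ht0, htv]
    ext z; revert z i; decide +kernel)
  have hxs : ∀ i, x i * s 0 = s i ^ mmExp i * x i := fun i => Subtype.ext (by
    simp only [Subgroup.coe_mul, Subgroup.coe_pow, hxv, hs0, hsv]
    ext z; revert z i; decide +kernel)
  have hxw : ∀ b < 7, ∃ k, (x k)⁻¹ * ((s 0 ^ b)⁻¹ * w) ∈ Subgroup.closure {t 0, s 0} := by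
    have aux : ∀ (b : ℕ) (k : Fin 8), k ≠ 0 → b + ccExp k = 7 ∨ b + ccExp k = 0 →
        (x k)⁻¹ * ((s 0 ^ b)⁻¹ * w) ∈ Subgroup.closure {t 0, s 0} := by
      intro b k hk hb
      have h1 : s 0 ^ b * s 0 ^ ccExp k = 1 := by
        rw [← pow_add]
        rcases hb with hb | hb
        · rw [hb, s7]
        · rw [hb, pow_zero]
      have h2 : (x k)⁻¹ * ((s 0 ^ b)⁻¹ * w) = (s 0 ^ ddExp k)⁻¹ := by
        simp only [x, if_neg hk]
        rw [inv_eq_of_mul_eq_one_right h1]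
        group
      rw [h2]
      exact inv_mem (pow_mem hsH _)
    intro b hb
    interval_cases b
    · exact ⟨1, aux _ _ (by decide) (by decide)⟩
    · exact ⟨4, aux _ _ (by decide) (by decide)⟩
    · exact ⟨6, aux _ _ (by decide) (by decide)⟩
    · exact ⟨5, aux _ _ (by decide) (by decide)⟩
    · exact ⟨7, aux _ _ (by decide) (by decide)⟩
    · exact ⟨3, aux _ _ (by decide) (by decide)⟩
    · exact ⟨2, aux _ _ (by decide) (by decide)⟩
  exact final_core hζ t s hcard hinj η hη V hV hdim w x (if_pos rfl) t3 s7 st w2 wt hM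
    (fun i => by rw [hxt, mul_inv_cancel_right])
    (fun i => by
      rw [hxs, mul_inv_cancel_right]
      exact pow_mem (Subgroup.subset_closure (by simp)) _) hxw
end

section
/- Let A₆ be the alternating group of degree 6 and let H₁, …, H₁₀ be the ten conjugates in A₆ of the subgroup H₁ = ⟨(3,5)(4,6), (1,2)(3,4,5,6), (1,4,6)⟩. Choose a_i ∈ A₆ with H_i = a_i H₁ a_i⁻¹, let η₁ be the degree-1 character of H₁ with η₁((1,2)(3,4,5,6)) = √−1, and let η_i be the character of H_i given by η_i(a_i x a_i⁻¹) = η₁(x). Set e_{η_i} = (1/36) Σ_{h∈H_i} η_i(h⁻¹)h ∈ ℚ(i)[A₆], and let e₇ be the central idempotent of the degree-10 irreducible character of A₆. Then e₇ = Σ_{i=1}^{10} e_{η_i}, and e_{η_i} e_{η_j} = δ_{ij} e_{η_i} for all i, j. -/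
open scoped Classical

/-- The alternating group on the six letters `{1,…,6} ⊆ Fin 7`. -/
def A6 : Subgroup (Equiv.Perm (Fin 7)) :=
  alternatingGroup (Fin 7) ⊓ MulAction.stabilizer (Equiv.Perm (Fin 7)) (0 : Fin 7)



open CategoryTheory in
theorem aux_simple {K G : Type} [Field K] [Group G] (V : FDRep K G) (hV : CategoryTheory.Simple V)
    (W : Submodule K V) (hW : ∀ g, ∀ v ∈ W, V.ρ g v ∈ W) : W = ⊥ ∨ W = ⊤ := by
  let σ : G →* (W →ₗ[K] W) :=
    { toFun := fun g => (V.ρ g).restrict (hW g)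
      map_one' := by ext v; simp
      map_mul' := by intro g h; ext v; simp }
  let U : FDRep K G := FDRep.of σ
  let f : U ⟶ V := ⟨InducedCategory.homMk (ModuleCat.ofHom W.subtype), fun g => by
    ext1
    ext v
    rfl⟩
  have hm : Mono f := by
    constructor
    intro Z g h hgh
    ext z
    exact congrArg (fun k : Z ⟶ V => k.hom.hom.hom z) hgh
  by_cases h0 : f = 0
  · left
    rw [eq_bot_iff]
    intro v hv
    have := congrArg (fun k : U ⟶ V => k.hom.hom.hom (⟨v, hv⟩ : W)) h0
    exact this
  · right
    have hi : IsIso f := (Simple.mono_isIso_iff_nonzero f).2 h0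
    rw [eq_top_iff]
    intro v _
    have h1 : inv f ≫ f = 𝟙 V := IsIso.inv_hom_id f
    have := congrArg (fun k : V ⟶ V => k.hom.hom.hom v) h1
    have h2 : ((((inv f).hom.hom.hom v : W)) : V) = v := this
    rw [← h2]
    exact Subtype.property _

theorem aux_trace {K V : Type} [Field K] [AddCommGroup V] [Module K V] [FiniteDimensional K V]
    (f : V →ₗ[K] V) (hf : f * f = f) : LinearMap.trace K V f = (Module.finrank K (LinearMap.range f) : K) := by
  have : LinearMap.IsProj (LinearMap.range f) f := by
    constructor
    · intro x; exact ⟨x, rfl⟩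
    · rintro _ ⟨x, rfl⟩
      exact congrArg (fun k : V →ₗ[K] V => k x) hf
  exact this.trace

theorem aux_order3 {K V : Type} [Field K] [CharZero K] [AddCommGroup V] [Module K V]
    [FiniteDimensional K V] (hd : Module.finrank K V = 10)
    (n Y : Module.End K V) (hn : n * n * n = 1) (hY : Y * Y = 1) (hYn : Y * n = n * n * Y) :
    LinearMap.trace K V (n * Y) = LinearMap.trace K V Y ∧
    LinearMap.trace K V (n * n * Y) = LinearMap.trace K V Y ∧
    LinearMap.trace K V (n * n) = LinearMap.trace K V n ∧
    ∃ r m : ℕ, (3 * r : K) = 10 + 2 * LinearMap.trace K V n ∧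
      (2 * m : K) = r + LinearMap.trace K V Y := by
  have h1 : LinearMap.trace K V (n * n * Y) = LinearMap.trace K V (n * Y) := by
    rw [← hYn, LinearMap.trace_mul_comm]
  have h2 : LinearMap.trace K V (n * Y) = LinearMap.trace K V Y := by
    have : n * Y = n * n * (n * n * Y) := by
      calc n * Y = n * n * n * n * Y := by rw [hn, one_mul]
        _ = _ := by noncomm_ring
    rw [this, ← hYn, LinearMap.trace_mul_comm]
    have : Y * n * (n * n) = Y := by rw [show Y * n * (n * n) = Y * (n * n * n) by noncomm_ring, hn, mul_one]
    rw [this]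
  have h3 : LinearMap.trace K V (n * n) = LinearMap.trace K V n := by
    have : n * n = Y * n * Y := by rw [hYn, mul_assoc, hY, mul_one]
    rw [this, mul_assoc, LinearMap.trace_mul_comm, mul_assoc, hY, mul_one]
  have hone : LinearMap.trace K V (1 : Module.End K V) = 10 := by
    rw [LinearMap.trace_one, hd]; norm_num
  refine ⟨h2, h1.trans h2, h3, ?_⟩
  obtain ⟨e, he⟩ : ∃ e, e = 1 + n + n * n := ⟨_, rfl⟩
  have hne : n * e = e := by
    rw [he]
    calc n * (1 + n + n * n) = n + n * n + n * n * n := by noncomm_ring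
      _ = _ := by rw [hn]; abel
  have hee : e * e = (3 : K) • e := by
    have : e * e = (1 + n + n * n) * e := by rw [← he]
    rw [this, add_mul, add_mul, one_mul, mul_assoc, hne, hne]
    module
  have hYe : Y * e = e * Y := by
    have h4 : Y * (n * n) = n * Y := by
      rw [← mul_assoc, hYn, mul_assoc, hYn]
      calc n * n * (n * n * Y) = n * n * n * n * Y := by noncomm_ring
        _ = _ := by rw [hn, one_mul]
    rw [he, mul_add, mul_add, h4, hYn]
    noncomm_ring
  obtain ⟨r, hr⟩ : ∃ r : ℕ, LinearMap.trace K V ((3 : K)⁻¹ • e) = r := ⟨_, aux_trace _ (by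
    rw [smul_mul_smul_comm, hee, smul_smul]; congr 1; norm_num)⟩
  obtain ⟨m, hm⟩ : ∃ m : ℕ, LinearMap.trace K V ((6 : K)⁻¹ • (e * (1 + Y))) = m := ⟨_, aux_trace _ (by
    have : e * (1 + Y) * (e * (1 + Y)) = (6 : K) • (e * (1 + Y)) := by
      calc e * (1 + Y) * (e * (1 + Y)) = e * (e + Y * e) * (1 + Y) := by noncomm_ring
        _ = (e * e) * (1 + Y + Y + Y * Y) := by rw [hYe]; noncomm_ring
        _ = _ := by
          rw [hee, hY, show 1 + Y + Y + 1 = (2 : K) • (1 + Y) by module, smul_mul_smul_comm]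
          norm_num
    rw [smul_mul_smul_comm, this, smul_smul]; congr 1; norm_num)⟩
  refine ⟨r, m, ?_, ?_⟩
  · rw [← hr, map_smul, he, map_add, map_add, hone, h3, smul_eq_mul]
    ring
  · rw [← hr, ← hm, mul_add, mul_one, map_smul, map_smul, map_add,
      show e * Y = Y + n * Y + n * n * Y by rw [he]; noncomm_ring, map_add, map_add, h1, h2,
      smul_eq_mul, smul_eq_mul]
    ring

theorem aux_Nfix {K V : Type} [Field K] [CharZero K] [AddCommGroup V] [Module K V]
    [FiniteDimensional K V] (hd : Module.finrank K V = 10)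
    (A B X : Module.End K V) (hA : A * A * A = 1) (hB : B * B * B = 1) (hAB : A * B = B * A)
    (hX : X * X * (X * X) = 1) (hXA : X * A = B * X) (hXB : X * B = A * A * X) :
    (1 + A + A * A) * (1 + B + B * B) ≠ 0 := by
  intro hP
  have hAA : A * A * (A * A) = A := by
    calc A * A * (A * A) = A * A * A * A := by noncomm_ring
      _ = _ := by rw [hA, one_mul]
  have hBB : B * B * (B * B) = B := by
    calc B * B * (B * B) = B * B * B * B := by noncomm_ring
      _ = _ := by rw [hB, one_mul]
  have hcAB : Commute A B := hAB
  have hXAA : X * (A * A) = B * B * X := by rw [← mul_assoc, hXA, mul_assoc, hXA, mul_assoc]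
  have hXBB : X * (B * B) = A * X := by
    rw [← mul_assoc, hXB, mul_assoc, hXB, ← mul_assoc, hAA]
  have hYA : X * X * A = A * A * (X * X) := by
    rw [mul_assoc, hXA, ← mul_assoc, hXB, mul_assoc]
  have hYB : X * X * B = B * B * (X * X) := by
    rw [mul_assoc, hXB, ← mul_assoc, hXAA, mul_assoc]
  have hsq : A * B * (A * B) = A * A * (B * B) := by
    rw [mul_assoc, ← mul_assoc B, ← hAB]; noncomm_ring
  have hsq' : A * (B * B) * (A * (B * B)) = A * A * B := by
    have : B * B * A = A * (B * B) := ((hcAB.mul_right hcAB).eq).symm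
    calc A * (B * B) * (A * (B * B)) = A * (B * B * A) * (B * B) := by noncomm_ring
      _ = A * A * (B * B * (B * B)) := by rw [this]; noncomm_ring
      _ = _ := by rw [hBB]
  have hYC : X * X * (A * B) = A * B * (A * B) * (X * X) := by
    rw [← mul_assoc, hYA, mul_assoc, hYB, hsq, mul_assoc (A * A)]
  have hYD : X * X * (A * (B * B)) = A * (B * B) * (A * (B * B)) * (X * X) := by
    rw [hsq']
    calc X * X * (A * (B * B)) = X * X * A * B * B := by noncomm_ring
      _ = A * A * (X * X * B) * B := by rw [hYA, mul_assoc (A * A) (X * X) B]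
      _ = A * A * (B * B * (X * X)) * B := by rw [hYB]
      _ = A * A * (B * B) * (X * X * B) := by noncomm_ring
      _ = A * A * (B * B * (B * B)) * (X * X) := by rw [hYB]; noncomm_ring
      _ = _ := by rw [hBB]
  have hC3 : A * B * (A * B) * (A * B) = 1 := by
    have : B * B * A = A * (B * B) := ((hcAB.mul_right hcAB).eq).symm
    rw [hsq]
    calc A * A * (B * B) * (A * B) = A * A * (B * B * A) * B := by noncomm_ring
      _ = (A * A * A) * (B * B * B) := by rw [this]; noncomm_ring
      _ = _ := by rw [hA, hB, one_mul]
  have hD3 : A * (B * B) * (A * (B * B)) * (A * (B * B)) = 1 := by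
    rw [hsq']
    calc A * A * B * (A * (B * B)) = A * A * (B * A) * (B * B) := by noncomm_ring
      _ = (A * A * A) * (B * B * B) := by rw [← hAB]; noncomm_ring
      _ = _ := by rw [hA, hB, one_mul]
  obtain ⟨tA1, tA2, tA3, r1, m1, hr1, hm1⟩ := aux_order3 hd A (X * X) hA hX hYA
  obtain ⟨tB1, tB2, tB3, -⟩ := aux_order3 hd B (X * X) hB hX hYB
  obtain ⟨tC1, tC2, tC3, r3, m3, hr3, hm3⟩ := aux_order3 hd (A * B) (X * X) hC3 hX hYC
  obtain ⟨tD1, tD2, tD3, -⟩ := aux_order3 hd (A * (B * B)) (X * X) hD3 hX hYD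
  rw [hsq] at tC2 tC3
  rw [hsq'] at tD2 tD3
  have conj : ∀ m n : Module.End K V, X * m = n * X →
      LinearMap.trace K V m = LinearMap.trace K V n := by
    intro m n h
    have h1 : n = X * m * (X * (X * X)) := by
      rw [h, mul_assoc, ← mul_assoc X X, hX, mul_one]
    rw [h1, LinearMap.trace_mul_comm, ← mul_assoc]
    rw [show X * (X * X) * X = X * X * (X * X) by noncomm_ring, hX, one_mul]
  have cAB : LinearMap.trace K V A = LinearMap.trace K V B := conj _ _ hXA
  have cCD : LinearMap.trace K V (A * B) = LinearMap.trace K V (A * A * B) := by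
    apply conj
    rw [← mul_assoc, hXA, mul_assoc, hXB, ← mul_assoc, (hcAB.mul_left hcAB).eq]
  have hone : LinearMap.trace K V (1 : Module.End K V) = 10 := by
    rw [LinearMap.trace_one, hd]; norm_num
  have e1 : (1 + A + A * A) * (1 + B + B * B) = 1 + A + A * A + B + B * B + A * B + A * A * (B * B)
      + A * (B * B) + A * A * B := by noncomm_ring
  have e2 := congrArg (LinearMap.trace K V) hP
  have e3 := congrArg (fun k => LinearMap.trace K V (k * (X * X))) hP
  rw [e1] at e2
  simp only [e1, add_mul, zero_mul, one_mul, map_add, map_zero] at e2 e3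
  have hτ : LinearMap.trace K V (X * X) = 0 := by
    have : (9 : K) * LinearMap.trace K V (X * X) = 0 := by linear_combination e3 - tA1 - tA2 - tB1 - tB2 - tC1 - tC2 - tD1 - tD2
    simpa using this
  have hfin : (2 * (m1 + m3) : K) = 5 := by
    rw [hτ] at hm1 hm3
    linear_combination hm1 + hm3 + (hr1 + hr3) / 3 + e2 / 6 - hone / 6 - (tA3 + tB3 + tC3 - tD3) / 6 + cAB / 3 + cCD / 3
  have : 2 * (m1 + m3) = 5 := by exact_mod_cast hfin
  omega

theorem aux_indep {K V G : Type} [Field K] [AddCommGroup V] [Module K V] [Group G]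
    [FiniteDimensional K V] (hd : Module.finrank K V = 10) (ρ : G →* Module.End K V)
    (hirr : ∀ W : Submodule K V, (∀ g, ∀ v ∈ W, ρ g v ∈ W) → W = ⊥ ∨ W = ⊤)
    (H : Subgroup G) (a b w : G)
    (hcov : ∀ g : G, g ∈ H ∨ ∃ i j : Fin 3, ∃ h ∈ H, g = a ^ (i : ℕ) * b ^ (j : ℕ) * w * h)
    (v : V) (hv : v ≠ 0) (hvH : ∀ h ∈ H, ∃ c : K, ρ h v = c • v) (c : K) :
    ((1 + ρ a + ρ a * ρ a) * (1 + ρ b + ρ b * ρ b)) (ρ w v) ≠ c • v := by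
  intro hc
  let f : Option (Fin 3 × Fin 3) → V := fun o =>
    o.elim v (fun p => ρ (a ^ (p.1 : ℕ) * b ^ (p.2 : ℕ) * w) v)
  have h1 : Submodule.span K (Set.range fun g => ρ g v) = ⊤ := by
    refine (hirr _ ?_).resolve_left ?_
    · intro g u hu
      have : Submodule.span K (Set.range fun g => ρ g v) ≤
          (Submodule.span K (Set.range fun g => ρ g v)).comap (ρ g) := by
        rw [Submodule.span_le]
        rintro _ ⟨g', rfl⟩
        refine Submodule.subset_span ⟨g * g', ?_⟩
        simp
      exact this hu
    · intro h
      rw [Submodule.span_eq_bot] at h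
      exact hv (h v ⟨1, by simp⟩)
  have h2 : ⊤ ≤ Submodule.span K (Set.range f) := by
    rw [← h1, Submodule.span_le]
    rintro _ ⟨g, rfl⟩
    rcases hcov g with hg | ⟨i, j, h, hh, rfl⟩
    · obtain ⟨d, hd⟩ := hvH g hg
      simp only [hd]
      exact Submodule.smul_mem _ _ (Submodule.subset_span ⟨none, rfl⟩)
    · obtain ⟨d, hd⟩ := hvH h hh
      have : ρ (a ^ (i : ℕ) * b ^ (j : ℕ) * w * h) v = d • f (some (i, j)) := by
        rw [map_mul, Module.End.mul_apply, hd, map_smul]; rfl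
      simp only [this]
      exact Submodule.smul_mem _ _ (Submodule.subset_span ⟨some (i, j), rfl⟩)
  have h3 : LinearIndependent K f :=
    linearIndependent_of_top_le_span_of_card_eq_finrank h2 (by rw [hd]; rfl)
  rw [Fintype.linearIndependent_iff] at h3
  have h4 := h3 (fun o => o.elim (-c) (fun _ => 1)) (by
    rw [Fintype.sum_option, Fintype.sum_prod_type]
    simp only [Fin.sum_univ_three, f, Option.elim, neg_smul, ← hc]
    simp [pow_two]
    abel) (some (0, 0))
  simp at h4

theorem aux_vec {K V G : Type} [Field K] [CharZero K] [AddCommGroup V] [Module K V] [Group G]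
    [FiniteDimensional K V] (hd : Module.finrank K V = 10) (ρ : G →* Module.End K V)
    (hirr : ∀ W : Submodule K V, (∀ g, ∀ v ∈ W, ρ g v ∈ W) → W = ⊥ ∨ W = ⊤)
    (ζ : K) (hζ : ζ * ζ = -1)
    (H : Subgroup G) (a b x w : G) (hH : H = Subgroup.closure {x * x, x, a})
    (hcov : ∀ g : G, g ∈ H ∨ ∃ i j : Fin 3, ∃ h ∈ H, g = a ^ (i : ℕ) * b ^ (j : ℕ) * w * h)
    (ha : a * a * a = 1) (hb : b * b * b = 1) (hab : a * b = b * a)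
    (hx : x * x * (x * x) = 1) (hxa : x * a = b * x) (hxb : x * b = a * a * x)
    (hw : w * w = 1) (hwx : x * w * x = w)
    (w01 : w * b * w = b * b * w * (b * b))
    (w02 : w * (b * b) * w = b * w * b)
    (w10 : w * a * w = a * w * (a * a * (x * x)))
    (w11 : w * (a * b) * w = a * a * b * w * (a * a * (b * b) * x))
    (w12 : w * (a * (b * b)) * w = a * a * (b * b) * w * (a * a * b * (x * (x * x))))
    (w20 : w * (a * a) * w = a * a * w * (a * (x * x)))
    (w21 : w * (a * a * b) * w = a * b * w * (a * (b * b) * (x * (x * x))))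
    (w22 : w * (a * a * (b * b)) * w = a * (b * b) * w * (a * b * x)) :
    ∃ v : V, v ≠ 0 ∧ ρ a v = v ∧ ρ x v = ζ • v := by
  obtain ⟨P, hP⟩ : ∃ P, P = (1 + ρ a + ρ a * ρ a) * (1 + ρ b + ρ b * ρ b) := ⟨_, rfl⟩
  have hPne : P ≠ 0 := by
    rw [hP]
    apply aux_Nfix hd (ρ a) (ρ b) (ρ x) <;> simp only [← map_mul, *, map_one]
  have hAs : ρ a * ρ b = ρ b * ρ a := by simp only [← map_mul, hab]
  have hA3 : ρ a * ρ a * ρ a = 1 := by simp only [← map_mul, ha, map_one]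
  have hB3 : ρ b * ρ b * ρ b = 1 := by simp only [← map_mul, hb, map_one]
  have hcomm : (1 + ρ b + ρ b * ρ b) * ρ a = ρ a * (1 + ρ b + ρ b * ρ b) := by
    have hc : Commute (ρ a) (ρ b) := hAs
    exact (((Commute.one_right _).add_right hc).add_right (hc.mul_right hc)).eq.symm
  have hcomm' : (1 + ρ a + ρ a * ρ a) * ρ b = ρ b * (1 + ρ a + ρ a * ρ a) := by
    have hc : Commute (ρ b) (ρ a) := hAs.symm
    exact (((Commute.one_right _).add_right hc).add_right (hc.mul_right hc)).eq.symm
  have e1 : ρ a * (1 + ρ a + ρ a * ρ a) = 1 + ρ a + ρ a * ρ a := by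
    calc ρ a * (1 + ρ a + ρ a * ρ a) = ρ a + ρ a * ρ a + ρ a * ρ a * ρ a := by noncomm_ring
      _ = _ := by rw [hA3]; abel
  have e1' : (1 + ρ a + ρ a * ρ a) * ρ a = 1 + ρ a + ρ a * ρ a := by
    calc (1 + ρ a + ρ a * ρ a) * ρ a = ρ a + ρ a * ρ a + ρ a * ρ a * ρ a := by noncomm_ring
      _ = _ := by rw [hA3]; abel
  have e2 : ρ b * (1 + ρ b + ρ b * ρ b) = 1 + ρ b + ρ b * ρ b := by
    calc ρ b * (1 + ρ b + ρ b * ρ b) = ρ b + ρ b * ρ b + ρ b * ρ b * ρ b := by noncomm_ring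
      _ = _ := by rw [hB3]; abel
  have e2' : (1 + ρ b + ρ b * ρ b) * ρ b = 1 + ρ b + ρ b * ρ b := by
    calc (1 + ρ b + ρ b * ρ b) * ρ b = ρ b + ρ b * ρ b + ρ b * ρ b * ρ b := by noncomm_ring
      _ = _ := by rw [hB3]; abel
  have aP : ρ a * P = P := by rw [hP, ← mul_assoc, e1]
  have bP : ρ b * P = P := by rw [hP, ← mul_assoc, ← hcomm', mul_assoc, e2]
  have Pa : P * ρ a = P := by rw [hP, mul_assoc, hcomm, ← mul_assoc, e1']
  have Pb : P * ρ b = P := by rw [hP, mul_assoc, e2']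
  have xP : ρ x * P = P * ρ x := by
    have hXA : ρ x * ρ a = ρ b * ρ x := by simp only [← map_mul, hxa]
    have hXB : ρ x * ρ b = ρ a * ρ a * ρ x := by simp only [← map_mul, hxb]
    have hXBB : ρ x * (ρ b * ρ b) = ρ a * ρ x := by
      rw [← mul_assoc, hXB, mul_assoc, hXB]
      calc ρ a * ρ a * (ρ a * ρ a * ρ x) = (ρ a * ρ a * ρ a) * ρ a * ρ x := by noncomm_ring
        _ = _ := by rw [hA3, one_mul]
    have hXAA : ρ x * (ρ a * ρ a) = ρ b * ρ b * ρ x := by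
      rw [← mul_assoc, hXA, mul_assoc, hXA, mul_assoc]
    have f1 : ρ x * (1 + ρ a + ρ a * ρ a) = (1 + ρ b + ρ b * ρ b) * ρ x := by
      rw [mul_add, mul_add, hXA, hXAA, add_mul, add_mul, mul_one, one_mul]
    have f2 : ρ x * (1 + ρ b + ρ b * ρ b) = (1 + ρ a + ρ a * ρ a) * ρ x := by
      rw [mul_add, mul_add, hXB, hXBB, add_mul, add_mul, mul_one, one_mul]; abel
    have hc : Commute (1 + ρ a + ρ a * ρ a) (1 + ρ b + ρ b * ρ b) := by
      have hc : Commute (ρ a) (ρ b) := hAs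
      have h2 : Commute (ρ a) (1 + ρ b + ρ b * ρ b) :=
        ((Commute.one_right _).add_right hc).add_right (hc.mul_right hc)
      exact ((Commute.one_left _).add_left h2).add_left (h2.mul_left h2)
    rw [hP, ← mul_assoc, f1, mul_assoc, f2, ← mul_assoc, hc.eq]
  have hgen : ∀ (v : V) (μ : K), μ * μ * (μ * μ) = 1 → ρ a v = v → ρ x v = μ • v →
      ∀ h ∈ H, ∃ c : K, ρ h v = c • v := by
    intro v μ hμ hav hxv h hh
    have h0 : ∃ c : K, c ≠ 0 ∧ ρ h v = c • v := by
      have hμ0 : μ ≠ 0 := by rintro rfl; simp at hμ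
      rw [hH] at hh
      induction hh using Subgroup.closure_induction with
      | mem y hy =>
        rcases hy with rfl | rfl | rfl
        · exact ⟨μ * μ, mul_ne_zero hμ0 hμ0, by simp [hxv, smul_smul]⟩
        · exact ⟨μ, hμ0, hxv⟩
        · exact ⟨1, one_ne_zero, by simp [hav]⟩
      | one => exact ⟨1, one_ne_zero, by simp⟩
      | mul y z _ _ hy hz =>
        obtain ⟨c, hc, hy⟩ := hy
        obtain ⟨d, hd, hz⟩ := hz
        exact ⟨d * c, mul_ne_zero hd hc, by simp [hy, hz, smul_smul]⟩
      | inv y _ hy =>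
        obtain ⟨c, hc, hy⟩ := hy
        refine ⟨c⁻¹, inv_ne_zero hc, ?_⟩
        have : ρ y⁻¹ (ρ y v) = v := by
          rw [← Module.End.mul_apply, ← map_mul]; simp
        rw [hy, map_smul] at this
        rw [eq_inv_smul_iff₀ hc, this]
    obtain ⟨c, -, hc⟩ := h0
    exact ⟨c, hc⟩
  have key : ∀ (v : V) (μ : K), v ≠ 0 → μ * μ * (μ * μ) = 1 → ρ a v = v → ρ x v = μ • v →
      ∀ c : K, P (ρ w v) ≠ c • v := by
    intro v μ hv hμ hav hxv c
    rw [hP]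
    exact aux_indep hd ρ hirr H a b w hcov v hv (hgen v μ hμ hav hxv) c
  -- properties of `y = P W v`
  have hy : ∀ (v : V) (μ ν : K), ν * μ = 1 → ρ x v = μ • v →
      ρ a (P (ρ w v)) = P (ρ w v) ∧ ρ x (P (ρ w v)) = ν • P (ρ w v) := by
    intro v μ ν hμ hxv
    refine ⟨by rw [← Module.End.mul_apply, aP], ?_⟩
    have h1 : ρ x (ρ w (ρ x v)) = ρ w v := by
      simp only [← Module.End.mul_apply, ← map_mul]
      rw [← mul_assoc, hwx]
    rw [hxv, map_smul, map_smul] at h1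
    have h2 : ρ x (ρ w v) = ν • ρ w v := by
      conv_rhs => rw [← h1]
      rw [smul_smul, hμ, one_smul]
    rw [← Module.End.mul_apply, xP, Module.End.mul_apply, h2, map_smul]
  have hb' : ∀ (v : V) (μ : K), ρ a v = v → ρ x v = μ • v → μ * μ * (μ * μ) = 1 → ρ b v = v := by
    intro v μ hav hxv hμ
    have hμ0 : μ ≠ 0 := by rintro rfl; simp at hμ
    have h1 : ρ x (ρ a v) = ρ b (ρ x v) := by
      simp only [← Module.End.mul_apply, ← map_mul, hxa]
    rw [hav, hxv, map_smul] at h1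
    exact (smul_right_injective V hμ0 h1).symm
  -- the square of the intertwining operator
  have hsq : ∀ (v : V) (μ : K), ρ a v = v → ρ x v = μ • v → μ * μ = 1 →
      P (ρ w (P (ρ w v))) = (9 : K) • v + (4 + 4 * μ) • P (ρ w v) := by
    intro v μ hav hxv hμ
    have hbv : ρ b v = v := hb' v μ hav hxv (by rw [hμ, one_mul])
    have E : ∀ g : G, P (ρ w (ρ g (ρ w v))) = P (ρ (w * g * w) v) := by
      intro g; simp [mul_assoc]
    have PA : ∀ u, P (ρ a u) = P u := fun u => by rw [← Module.End.mul_apply, Pa]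
    have PB : ∀ u, P (ρ b u) = P u := fun u => by rw [← Module.End.mul_apply, Pb]
    have hexp : P (ρ w v) = ρ 1 (ρ w v) + ρ a (ρ w v) + ρ (a * a) (ρ w v) + ρ b (ρ w v)
        + ρ (b * b) (ρ w v) + ρ (a * b) (ρ w v) + ρ (a * a * (b * b)) (ρ w v)
        + ρ (a * (b * b)) (ρ w v) + ρ (a * a * b) (ρ w v) := by
      rw [hP]; simp; abel
    have hPv : P v = (9 : K) • v := by
      rw [hP]
      simp [hav, hbv]
      module
    have hμ3 : μ * (μ * μ) = μ := by rw [hμ, mul_one]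
    conv_lhs => rw [hexp]
    simp only [map_add, E, w01, w02, w10, w11, w12, w20, w21, w22, mul_one, hw]
    rw [map_one, Module.End.one_apply, hPv]
    simp only [map_mul, Module.End.mul_apply, hxv, map_smul, hav, hbv, PA, PB, smul_smul, hμ]
    module
  -- the characters `±1` do not occur
  have hno : ∀ (v : V) (μ l : K), ρ a v = v → ρ x v = μ • v → μ * μ = 1 →
      l * (4 + 4 * μ + l) = 9 → v = 0 := by
    intro v μ l hav hxv hμ hl
    by_contra hv
    have hμ4 : μ * μ * (μ * μ) = 1 := by rw [hμ, one_mul]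
    obtain ⟨hya, hyx⟩ := hy v μ μ hμ hxv
    refine key (P (ρ w v) + l • v) μ ?_ hμ4 ?_ ?_ (4 + 4 * μ + l) ?_
    · intro h
      refine key v μ hv hμ4 hav hxv (-l) ?_
      rw [neg_smul, eq_neg_iff_add_eq_zero, h]
    · rw [map_add, map_smul, hya, hav]
    · rw [map_add, map_smul, hyx, hxv]; module
    · rw [map_add, map_add, map_smul, map_smul, hsq v μ hav hxv hμ, ← hl]
      module
  obtain ⟨u₀, hu₀⟩ : ∃ u₀, P u₀ ≠ 0 := by
    by_contra! h
    exact hPne (LinearMap.ext h)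
  have hX4 : ∀ u, ρ x (ρ x (ρ x (ρ x u))) = u := by
    intro u
    simp only [← Module.End.mul_apply, ← map_mul]
    have h : x * x * x * x = 1 := by rw [← hx]; simp only [mul_assoc]
    simp only [← mul_assoc, h]
    simp
  obtain ⟨u, hu⟩ : ∃ u : K → V, u = fun μ => P u₀ + (μ * μ * μ) • ρ x (P u₀)
      + (μ * μ) • ρ x (ρ x (P u₀)) + μ • ρ x (ρ x (ρ x (P u₀))) := ⟨_, rfl⟩
  have hPx : ∀ u, ρ x (P u) = P (ρ x u) := fun u => by
    rw [← Module.End.mul_apply, xP, Module.End.mul_apply]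
  have hua : ∀ μ, ρ a (u μ) = u μ := by
    intro μ
    have aP' : ∀ u, ρ a (P u) = P u := fun u => by rw [← Module.End.mul_apply, aP]
    simp only [hu, hPx, map_add, map_smul, aP']
  have hux : ∀ μ, μ * μ * (μ * μ) = 1 → ρ x (u μ) = μ • u μ := by
    intro μ hμ
    simp only [hu, map_add, map_smul, hX4, smul_add, smul_smul]
    rw [show μ * (μ * μ * μ) = 1 by rw [← hμ]; ring]
    module
  have hsum : u 1 + u (-1) + u ζ + u (-ζ) = (4 : K) • P u₀ := by
    simp only [hu, neg_mul, mul_neg, hζ]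
    module
  have h1 : u 1 = 0 := hno _ 1 1 (hua 1) (hux 1 (by norm_num)) (by norm_num) (by norm_num)
  have h2 : u (-1) = 0 :=
    hno _ (-1) 3 (hua _) (hux _ (by norm_num)) (by norm_num) (by norm_num)
  have hζ4 : ζ * ζ * (ζ * ζ) = 1 := by rw [hζ]; norm_num
  by_cases h3 : u ζ = 0
  · have h4 : u (-ζ) ≠ 0 := by
      intro h4
      rw [h1, h2, h3, h4] at hsum
      exact hu₀ ((smul_eq_zero.1 (hsum.symm.trans (by simp))).resolve_left (by norm_num))
    have hx4 := hux (-ζ) (by rw [← hζ4]; ring)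
    obtain ⟨hya, hyx⟩ := hy (u (-ζ)) (-ζ) ζ (by rw [mul_neg, hζ, neg_neg]) hx4
    refine ⟨_, ?_, hya, hyx⟩
    have := key (u (-ζ)) (-ζ) h4 (by rw [← hζ4]; ring) (hua _) hx4 0
    rwa [zero_smul] at this
  · exact ⟨u ζ, h3, hua ζ, hux ζ hζ4⟩

/-- Extension by zero of a function on a subgroup. -/
noncomputable def ext0 {G : Type} [Group G] {K : Type} [Field K] (H : Subgroup G) (ψ : H → K)
    (g : G) : K := if h : g ∈ H then ψ ⟨g, h⟩ else 0

theorem aux_subIdem {G : Type} [Group G] [Fintype G] {K : Type} [Field K]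
    (H : Subgroup G) (ψ : H → K) :
    subIdem H ψ = (Nat.card H : K)⁻¹ • ∑ g : G, MonoidAlgebra.single g (ext0 H ψ g⁻¹) := by
  unfold subIdem
  rw [Fintype.card_eq_nat_card]
  congr 1
  refine Fintype.sum_of_injective (Subtype.val : H → G) Subtype.val_injective _ _ ?_ ?_
  · intro g hg
    have : g⁻¹ ∉ H := by
      intro h
      exact hg ⟨⟨g, by simpa using H.inv_mem h⟩, rfl⟩
    rw [ext0, dif_neg this]
    simp
  · intro h
    have : (h : G)⁻¹ ∈ H := H.inv_mem h.2
    rw [ext0, dif_pos this]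
    rfl

theorem aux_alg {G : Type} [Group G] [Fintype G] {K : Type} [Field K] [CharZero K]
    (H : Subgroup G) (ψ : H →* K) (h : G) (hh : h ∈ H) :
    MonoidAlgebra.single h 1 * subIdem H ψ = ψ ⟨h, hh⟩ • subIdem H ψ ∧
    subIdem H ψ * MonoidAlgebra.single h 1 = ψ ⟨h, hh⟩ • subIdem H ψ := by
  have hinv : ψ ⟨h, hh⟩ * ψ ⟨h, hh⟩⁻¹ = 1 := by rw [← map_mul]; simp
  constructor
  · unfold subIdem
    rw [mul_smul_comm, smul_comm, Finset.mul_sum]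
    congr 1
    rw [← Equiv.sum_comp (Equiv.mulLeft (⟨h, hh⟩ : H)⁻¹), Finset.smul_sum]
    refine Finset.sum_congr rfl fun k _ => ?_
    simp [MonoidAlgebra.single_mul_single, mul_comm]
  · unfold subIdem
    rw [smul_mul_assoc, smul_comm, Finset.sum_mul]
    congr 1
    rw [← Equiv.sum_comp (Equiv.mulRight (⟨h, hh⟩ : H)⁻¹), Finset.smul_sum]
    refine Finset.sum_congr rfl fun k _ => ?_
    simp [MonoidAlgebra.single_mul_single, mul_comm]

theorem aux_sum_apply {G : Type} [Group G] [Fintype G] {K A : Type} [Field K] [CharZero K]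
    [AddCommGroup A] [Module K A]
    (H : Subgroup G) (ψ : H →* K) (f : MonoidAlgebra K G →ₗ[K] A) (y : A)
    (hf : ∀ h : H, f (MonoidAlgebra.single (h : G) 1) = ψ h • y) : f (subIdem H ψ) = y := by
  unfold subIdem
  rw [map_smul, map_sum]
  have : ∀ h : H, f (MonoidAlgebra.single (h : G) (ψ h⁻¹)) = y := by
    intro h
    have h1 : MonoidAlgebra.single (h : G) (ψ h⁻¹) = ψ h⁻¹ • MonoidAlgebra.single (h : G) (1 : K) := by
      simp
    rw [h1, map_smul, hf, smul_smul, ← map_mul]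
    simp
  rw [Finset.sum_congr rfl fun h _ => this h, Finset.sum_const, Finset.card_univ,
    ← Nat.cast_smul_eq_nsmul K, smul_smul, inv_mul_cancel₀, one_smul]
  exact_mod_cast Fintype.card_ne_zero

theorem aux_idem {G : Type} [Group G] [Fintype G] {K : Type} [Field K] [CharZero K]
    (H : Subgroup G) (ψ : H →* K) : subIdem H ψ * subIdem H ψ = subIdem H ψ := by
  exact aux_sum_apply H ψ (LinearMap.mulRight K (subIdem H ψ)) _ fun h => by
    simpa using (aux_alg H ψ h h.2).1

theorem aux_main {G : Type} [Group G] [Fintype G] {K : Type} [Field K] [CharZero K]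
    {V : Type} [AddCommGroup V] [Module K V] [FiniteDimensional K V]
    (hd : Module.finrank K V = 10) (ρ : G →* Module.End K V)
    (ζ : K) (hζ : ζ * ζ = -1)
    (H : Fin 10 → Subgroup G) (s : Fin 10 → G) (a b x w : G)
    (hH0 : H 0 = Subgroup.closure {x * x, x, a})
    (hH : ∀ i, H i = conjSub (s i) (H 0))
    (hHinj : Function.Injective H)
    (hcov : ∀ g : G, g ∈ H 0 ∨
      ∃ i j : Fin 3, ∃ h ∈ H 0, g = a ^ (i : ℕ) * b ^ (j : ℕ) * w * h)
    (hbH : b ∈ H 0) (hwx : x * w * x = w)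
    (ψ : H 0 →* K)
    (hψx : ∀ h : x ∈ H 0, ψ ⟨x, h⟩ = ζ) (hψa : ∀ h : a ∈ H 0, ψ ⟨a, h⟩ = 1)
    (η : ∀ i, H i →* K)
    (hη : ∀ (i) (y : G) (hy : y ∈ H 0) (hy' : s i * y * (s i)⁻¹ ∈ H i),
      η i ⟨s i * y * (s i)⁻¹, hy'⟩ = ψ ⟨y, hy⟩)
    (hvec : ∃ v : V, v ≠ 0 ∧ ρ a v = v ∧ ρ x v = ζ • v) :
    cenIdem (fun g => LinearMap.trace K V (ρ g)) 10 = ∑ i, subIdem (H i) (η i) ∧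
    ∀ i j, subIdem (H i) (η i) * subIdem (H j) (η j) =
      if i = j then subIdem (H i) (η i) else 0 := by
  have hxH : x ∈ H 0 := by rw [hH0]; exact Subgroup.subset_closure (by simp)
  have haH : a ∈ H 0 := by rw [hH0]; exact Subgroup.subset_closure (by simp)
  obtain ⟨e, he⟩ : ∃ e, e = subIdem (H 0) ψ := ⟨_, rfl⟩
  have hee : e * e = e := by rw [he]; exact aux_idem _ _
  have hl : ∀ h (hh : h ∈ H 0), MonoidAlgebra.single h 1 * e = ψ ⟨h, hh⟩ • e := by
    intro h hh; rw [he]; exact (aux_alg _ _ h hh).1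
  have hr : ∀ h (hh : h ∈ H 0), e * MonoidAlgebra.single h 1 = ψ ⟨h, hh⟩ • e := by
    intro h hh; rw [he]; exact (aux_alg _ _ h hh).2
  have hs : ∀ g h : G, MonoidAlgebra.single (g * h) (1 : K)
      = MonoidAlgebra.single g 1 * MonoidAlgebra.single h 1 := by
    intro g h; simp [MonoidAlgebra.single_mul_single]
  have hwe : e * MonoidAlgebra.single w 1 * e = 0 := by
    have h1 : e * MonoidAlgebra.single w 1 * e = -(e * MonoidAlgebra.single w 1 * e) := by
      conv_lhs => rw [← hwx, hs, hs]
      calc e * (MonoidAlgebra.single x 1 * MonoidAlgebra.single w 1 * MonoidAlgebra.single x 1) * e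
          = (e * MonoidAlgebra.single x 1) * MonoidAlgebra.single w 1
            * (MonoidAlgebra.single x 1 * e) := by simp only [mul_assoc]
        _ = _ := by
          rw [hr x hxH, hl x hxH, hψx, smul_mul_assoc, smul_mul_smul_comm, hζ]
          simp
    have h2 : (2 : K) • (e * MonoidAlgebra.single w 1 * e) = 0 := by
      rw [two_smul]
      nth_rewrite 1 [h1]
      simp
    exact (smul_eq_zero.1 h2).resolve_left (by norm_num)
  have hout : ∀ g, g ∉ H 0 → e * MonoidAlgebra.single g 1 * e = 0 := by
    intro g hg
    obtain ⟨i, j, h, hh, rfl⟩ := (hcov g).resolve_left hg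
    have hn : a ^ (i : ℕ) * b ^ (j : ℕ) ∈ H 0 := mul_mem (pow_mem haH _) (pow_mem hbH _)
    rw [hs, hs]
    calc e * (MonoidAlgebra.single (a ^ (i : ℕ) * b ^ (j : ℕ)) 1 * MonoidAlgebra.single w 1
            * MonoidAlgebra.single h 1) * e
          = (e * MonoidAlgebra.single (a ^ (i : ℕ) * b ^ (j : ℕ)) 1) * MonoidAlgebra.single w 1
            * (MonoidAlgebra.single h 1 * e) := by simp only [mul_assoc]
        _ = _ := by
          rw [hr _ hn, hl h hh, smul_mul_assoc, smul_mul_smul_comm, hwe, smul_zero]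
  have hgege : ∀ g, e * MonoidAlgebra.single g 1 * e = ext0 (H 0) ψ g • e := by
    intro g
    by_cases hg : g ∈ H 0
    · rw [hr g hg, smul_mul_assoc, hee, ext0, dif_pos hg]
    · rw [hout g hg, ext0, dif_neg hg, zero_smul]
  have hmem : ∀ i y, s i * y * (s i)⁻¹ ∈ H i ↔ y ∈ H 0 := by
    intro i y
    rw [hH i, conjSub]
    constructor
    · rintro ⟨z, hz, hzy⟩
      have : s i * z * (s i)⁻¹ = s i * y * (s i)⁻¹ := hzy
      have : z = y := by simpa using this
      exact this ▸ hz
    · intro hy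
      exact ⟨y, hy, rfl⟩
  have hcard : ∀ i, Nat.card (H i) = Nat.card (H 0) := by
    intro i
    rw [hH i, conjSub]
    exact Nat.card_congr ((H 0).equivMapOfInjective _ (MulAut.conj (s i)).injective).toEquiv.symm
  have hext : ∀ i y, ext0 (H i) (η i) (s i * y * (s i)⁻¹) = ext0 (H 0) ψ y := by
    intro i y
    by_cases hy : y ∈ H 0
    · rw [ext0, ext0, dif_pos hy, dif_pos ((hmem i y).2 hy), hη i y hy]
    · rw [ext0, ext0, dif_neg hy, dif_neg (fun h => hy ((hmem i y).1 h))]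
  have hconj : ∀ i, subIdem (H i) (η i)
      = MonoidAlgebra.single (s i) 1 * e * MonoidAlgebra.single (s i)⁻¹ 1 := by
    intro i
    rw [he, aux_subIdem, aux_subIdem, hcard i, mul_smul_comm, smul_mul_assoc]
    congr 1
    rw [Finset.mul_sum, Finset.sum_mul, ← Equiv.sum_comp (MulAut.conj (s i)).toEquiv]
    refine Finset.sum_congr rfl fun g _ => ?_
    have : ((MulAut.conj (s i)).toEquiv g)⁻¹ = s i * g⁻¹ * (s i)⁻¹ := by
      simp [MulAut.conj_apply, mul_assoc]
    rw [this, hext]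
    simp [MonoidAlgebra.single_mul_single, MulAut.conj_apply]
  have hinj : ∀ i j, (s i)⁻¹ * s j ∈ H 0 → i = j := by
    intro i j h
    apply hHinj
    ext g
    have e1 : g = s i * ((s i)⁻¹ * g * s i) * (s i)⁻¹ := by group
    have e2 : g = s j * ((s j)⁻¹ * g * s j) * (s j)⁻¹ := by group
    conv_lhs => rw [e1, hmem]
    conv_rhs => rw [e2, hmem]
    have e3 : (s i)⁻¹ * g * s i = ((s i)⁻¹ * s j) * ((s j)⁻¹ * g * s j) * ((s i)⁻¹ * s j)⁻¹ := by
      group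
    rw [e3, Subgroup.mul_mem_cancel_right _ (inv_mem h), Subgroup.mul_mem_cancel_left _ h]
  have horth : ∀ i j, subIdem (H i) (η i) * subIdem (H j) (η j) =
      if i = j then subIdem (H i) (η i) else 0 := by
    intro i j
    have h1 : subIdem (H i) (η i) * subIdem (H j) (η j) = MonoidAlgebra.single (s i) 1 *
        (e * MonoidAlgebra.single ((s i)⁻¹ * s j) 1 * e) * MonoidAlgebra.single (s j)⁻¹ 1 := by
      rw [hconj, hconj, hs]; simp only [mul_assoc]
    split_ifs with hij
    · subst hij
      rw [h1, inv_mul_cancel, ← MonoidAlgebra.one_def, mul_one, hee, hconj]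
    · rw [h1, hout _ (fun h => hij (hinj i j h))]
      simp
  refine ⟨?_, horth⟩
  have hindex : (H 0).index = 10 := by
    apply le_antisymm
    · let f : Option (Fin 3 × Fin 3) → G ⧸ H 0 := fun o =>
        o.elim ((1 : G) : G ⧸ H 0) (fun p => ((a ^ (p.1 : ℕ) * b ^ (p.2 : ℕ) * w : G) : G ⧸ H 0))
      have hf : Function.Surjective f := by
        intro q
        induction q using QuotientGroup.induction_on with
        | H g =>
          rcases hcov g with hg | ⟨i, j, h, hh, rfl⟩
          · exact ⟨none, QuotientGroup.eq.2 (by simpa using hg)⟩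
          · exact ⟨some (i, j), QuotientGroup.eq.2 (by rw [inv_mul_cancel_left]; exact hh)⟩
      have := Nat.card_le_card_of_surjective f hf
      simpa [Subgroup.index] using this
    · let f : Fin 10 → G ⧸ H 0 := fun i => (s i : G ⧸ H 0)
      have hf : Function.Injective f := fun i j h => hinj i j (QuotientGroup.eq.1 h)
      have := Nat.card_le_card_of_injective f hf
      simpa [Subgroup.index] using this
  have hcG : Nat.card (H 0) * 10 = Nat.card G := by
    have h10 := (H 0).card_mul_index
    rw [hindex] at h10
    exact h10
  -- the representation of the group algebra
  obtain ⟨R, hR⟩ : ∃ R : MonoidAlgebra K G →ₐ[K] Module.End K V, R = MonoidAlgebra.lift K (Module.End K V) G ρ :=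
    ⟨_, rfl⟩
  have hRs : ∀ g, R (MonoidAlgebra.single g 1) = ρ g := by
    intro g; rw [hR]; simp
  obtain ⟨v, hv0, hva, hvx⟩ := hvec
  have hvH : ∀ h (hh : h ∈ H 0), ρ h v = ψ ⟨h, hh⟩ • v := by
    intro h hh
    have : ∀ (h' : h ∈ Subgroup.closure {x * x, x, a}), ∀ (hh : h ∈ H 0), ρ h v = ψ ⟨h, hh⟩ • v := by
      intro h'
      induction h' using Subgroup.closure_induction with
      | mem y hy =>
        intro hh
        rcases hy with rfl | rfl | rfl
        · have : ψ ⟨x * x, hh⟩ = ζ * ζ := by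
            rw [← hψx hxH, ← map_mul]; rfl
          rw [this]; simp [hvx, smul_smul]
        · rw [hψx, hvx]
        · rw [hψa, hva, one_smul]
      | one =>
        intro hh
        have : ψ ⟨1, hh⟩ = 1 := map_one ψ
        rw [this]; simp
      | mul y z hy' hz' hy hz =>
        intro hh
        rw [← hH0] at hy' hz'
        have : ψ ⟨y * z, hh⟩ = ψ ⟨y, hy'⟩ * ψ ⟨z, hz'⟩ := by rw [← map_mul]; rfl
        rw [this, map_mul, Module.End.mul_apply, hz hz', map_smul, hy hy', smul_smul, mul_comm]
      | inv y hy' hy =>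
        intro hh
        rw [← hH0] at hy'
        have h1 : ψ ⟨y⁻¹, hh⟩ * ψ ⟨y, hy'⟩ = 1 := by
          rw [← map_mul, ← map_one ψ]; congr 1; ext; simp
        have h2 : ρ y⁻¹ (ρ y v) = v := by
          rw [← Module.End.mul_apply, ← map_mul]; simp
        rw [hy hy' hy', map_smul] at h2
        conv_rhs => rw [← h2]
        rw [smul_smul, h1, one_smul]
    exact this (hH0 ▸ hh) hh
  have hRe : R e ≠ 0 := by
    intro h0
    have h1 : (LinearMap.applyₗ v ∘ₗ R.toLinearMap : MonoidAlgebra K G →ₗ[K] V) e = v := by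
      rw [he]
      apply aux_sum_apply
      intro h
      simp [hRs, hvH h h.2]
    apply hv0
    rw [← h1]
    simp [h0]
  have hRee : R e * R e = R e := by rw [← map_mul, hee]
  have htr : ∀ i, LinearMap.trace K V (R (subIdem (H i) (η i))) = LinearMap.trace K V (R e) := by
    intro i
    rw [hconj, map_mul, LinearMap.trace_mul_comm, ← map_mul, ← mul_assoc, ← hs, inv_mul_cancel,
      ← MonoidAlgebra.one_def, one_mul]
  obtain ⟨z, hz⟩ : ∃ z, z = ∑ i, subIdem (H i) (η i) := ⟨_, rfl⟩
  have hzz : z * z = z := by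
    rw [hz, Finset.sum_mul_sum]
    simp [horth]
  have htz : LinearMap.trace K V (R z) = 10 * LinearMap.trace K V (R e) := by
    rw [hz, map_sum, map_sum, Finset.sum_congr rfl fun i _ => htr i]
    simp
  have hRzz : R z * R z = R z := by rw [← map_mul, hzz]
  obtain ⟨r, hr1⟩ : ∃ r : ℕ, LinearMap.trace K V (R e) = r := ⟨_, aux_trace _ hRee⟩
  have hr0 : r ≠ 0 := by
    rintro rfl
    apply hRe
    exact LinearMap.IsIdempotentElem.eq_zero_of_trace_eq_zero hRee (by simpa using hr1)
  have hone : LinearMap.trace K V (1 : Module.End K V) = 10 := by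
    rw [LinearMap.trace_one, hd]; norm_num
  have hrk : Module.finrank K (LinearMap.range (R z)) = 10 * r := by
    have h1 := aux_trace _ hRzz
    rw [htz, hr1] at h1
    exact_mod_cast h1.symm
  have hr2 : r = 1 := by
    have := Submodule.finrank_le (LinearMap.range (R z))
    omega
  have hRz : R z = 1 := by
    have h1 : (1 - R z) * (1 - R z) = 1 - R z := by
      rw [mul_sub, sub_mul, sub_mul, hRzz]; simp
    have h2 := LinearMap.IsIdempotentElem.eq_zero_of_trace_eq_zero h1 (by
      rw [map_sub, hone, htz, hr1, hr2]; simp)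
    exact (sub_eq_zero.1 h2).symm
  have hchar : ∀ g, LinearMap.trace K V (ρ g) = ∑ i, ext0 (H 0) ψ ((s i)⁻¹ * g * s i) := by
    intro g
    have h1 : ρ g = R (z * MonoidAlgebra.single g 1) := by
      rw [map_mul, hRz, one_mul, hRs]
    rw [h1, hz, Finset.sum_mul, map_sum, map_sum]
    refine Finset.sum_congr rfl fun i _ => ?_
    have h2 : subIdem (H i) (η i) * MonoidAlgebra.single g 1 =
        MonoidAlgebra.single (s i) 1 * e * (e * (MonoidAlgebra.single (s i)⁻¹ 1 * MonoidAlgebra.single g 1)) := by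
      rw [hconj]
      conv_lhs => rw [← hee]
      simp only [mul_assoc]
    rw [h2, map_mul, LinearMap.trace_mul_comm, ← map_mul]
    have h3 : e * (MonoidAlgebra.single (s i)⁻¹ 1 * MonoidAlgebra.single g 1) *
        (MonoidAlgebra.single (s i) 1 * e) = ext0 (H 0) ψ ((s i)⁻¹ * g * s i) • e := by
      rw [← hgege, hs, hs]; simp only [mul_assoc]
    rw [h3, map_smul, map_smul, hr1, hr2]
    simp
  rw [cenIdem, Fintype.card_eq_nat_card]
  have hq : (10 : K) / (Nat.card G : K) = (Nat.card (H 0) : K)⁻¹ := by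
    rw [← hcG]
    have : (Nat.card (H 0) : K) ≠ 0 := by exact_mod_cast Nat.card_pos.ne'
    push_cast
    field_simp
  rw [hq]
  simp only [aux_subIdem, hcard]
  rw [← Finset.smul_sum]
  congr 1
  rw [Finset.sum_comm]
  refine Finset.sum_congr rfl fun g _ => ?_
  have hss : ∀ c : K, MonoidAlgebra.single g c = c • MonoidAlgebra.single g (1 : K) := by
    intro c; simp
  rw [hchar, hss, Finset.sum_smul]
  refine Finset.sum_congr rfl fun i _ => ?_
  rw [← hss]
  congr 1
  rw [← hext i]
  congr 1
  group

/-- the code of a permutation, read off from its values at `1, …, 6` -/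
def aenc (p : Equiv.Perm (Fin 7)) : ℕ :=
  (p 1).val + 8 * (p 2).val + 64 * (p 3).val + 512 * (p 4).val + 4096 * (p 5).val + 32768 * (p 6).val

def pa : Equiv.Perm (Fin 7) := c[(1 : Fin 7), 4, 6]
def pb : Equiv.Perm (Fin 7) := c[(2 : Fin 7), 5, 3]
def px : Equiv.Perm (Fin 7) := c[(1 : Fin 7), 2] * c[(3 : Fin 7), 4, 5, 6]
def pww : Equiv.Perm (Fin 7) := c[(1 : Fin 7), 2] * c[(3 : Fin 7), 5]

def hword (i j : Fin 3) (k : Fin 4) : Equiv.Perm (Fin 7) :=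
  pa ^ (i : ℕ) * pb ^ (j : ℕ) * px ^ (k : ℕ)

def nword (i j : Fin 3) : Equiv.Perm (Fin 7) := pa ^ (i : ℕ) * pb ^ (j : ℕ) * pww

def hcodes : List ℕ :=
  [219345, 125706, 146769, 182154, 211113, 91917, 142569, 116109, 207193, 189707,
   154777, 84875, 56532, 105378, 209748, 190050, 48300, 71589, 205548, 124005,
   44380, 169379, 217756, 92771, 152278, 117362, 47446, 169778, 144046, 83573,
   43246, 103733, 140126, 181363, 55454, 72499]

def ncodes : List ℕ :=
  [211274, 190225, 154826, 117649, 219226, 60179, 138586, 181139, 202986, 123669,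
   146538, 51093, 81228, 173985, 218316, 125601, 89180, 43939, 202076, 189091,
   72940, 107429, 210028, 59045, 144718, 181937, 88270, 109361, 152670, 51891,
   72030, 172851, 136430, 115381, 79982, 42805, 207053, 124201, 146573, 83881,
   211029, 59178, 138453, 115626, 202909, 90923, 142429, 50603, 175308, 120225,
   211596, 92001, 179284, 55202, 203476, 123746, 171164, 86947, 207452, 58723,
   142030, 116081, 178318, 87857, 146006, 51058, 170198, 119602, 137886, 82803,
   174174, 54579, 219275, 92953, 142667, 181657, 206955, 58653, 138411, 82845,
   203091, 189210, 154707, 52122, 121996, 80801, 206668, 189665, 109676, 46501,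
   202412, 90853, 105812, 177058, 218708, 60130, 153230, 84721, 108878, 177457,
   140910, 50421, 104622, 78645, 137046, 180978, 120918, 47922, 48482, 169876,
   217826, 125524, 56602, 138131, 213850, 190547, 52458, 104853, 209706, 157269,
   78694, 173684, 54502, 105140, 86814, 141939, 50526, 170163, 82670, 108661,
   46382, 136885, 210273, 190092, 89313, 109452, 218393, 158347, 85337, 174475,
   214249, 125069, 81193, 141197, 44261, 103852, 209573, 91756, 48405, 137130,
   213717, 125034, 52381, 72107, 205597, 156779, 172774, 119924, 47782, 71540,
   176918, 153202, 51926, 104818, 180894, 88179, 43806, 136563, 207585, 124236,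
   179361, 87948, 211729, 157514, 183505, 121226, 215705, 92491, 175385, 152971,
   56483, 72604, 205667, 189532, 44331, 136605, 213675, 92253, 52563, 170394,
   217875, 158298, 119462, 80500, 42854, 169204, 107310, 144501, 50862, 71925,
   115542, 178290, 55062, 137970, 218785, 92876, 109921, 177548, 206633, 156877,
   117929, 80269, 214865, 190666, 122129, 146314, 144242, 181846, 55538, 105238,
   152474, 215635, 59738, 171283, 156394, 117845, 47530, 202517, 80241, 173838,
   152817, 117390, 88473, 207627, 157017, 183435, 92393, 109837, 144809, 214669,
   46452, 169638, 86772, 109158, 54684, 203427, 90972, 175203, 58604, 105637,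
   78764, 206437, 140021, 115822, 47285, 71470, 144277, 214634, 59605, 105770,
   156317, 85099, 43421, 202027, 174321, 120078, 146097, 83790, 178577, 218890,
   158417, 118090, 190617, 89355, 142233, 214347, 43764, 103782, 176820, 87654,
   48020, 202594, 189140, 121954, 60060, 73059, 172956, 218211, 152243, 84574,
   43379, 169246, 140203, 214109, 59563, 72989, 156499, 183386, 55699, 203546,
   121009, 80654, 141169, 181454, 108969, 210189, 157353, 85197, 125265, 179466,
   153489, 215754, 54964, 72422, 107380, 177254, 42924, 201957, 123564, 80997,
   59220, 171234, 119700, 211554]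

set_option maxRecDepth 100000 in
theorem hcodes_eq : (List.finRange 3).flatMap (fun i => (List.finRange 3).flatMap fun j =>
    (List.finRange 4).map fun k => aenc (hword i j k)) = hcodes := by
  decide +kernel

set_option maxRecDepth 100000 in
theorem ncodes_eq : (List.finRange 3).flatMap (fun i => (List.finRange 3).flatMap fun j =>
    (List.finRange 3).flatMap (fun i' => (List.finRange 3).flatMap fun j' =>
    (List.finRange 4).map fun k => aenc (nword i j * hword i' j' k))) = ncodes := by
  decide +kernel

/-- Boolean membership test for the table of codes -/
def inCodes (a1 a2 a3 a4 a5 a6 : Fin 7) : Bool :=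
  (hcodes ++ ncodes).any (fun n => Nat.beq n
    (a1.val + 8 * a2.val + 64 * a3.val + 512 * a4.val + 4096 * a5.val + 32768 * a6.val))

/-- Boolean test that a value is new -/
def isNew (c : Fin 7) (l : List (Fin 7)) : Bool := l.all (fun d => !(Nat.beq c.val d.val))

def forallFin (P : Fin 7 → Bool) : Bool := P 0 && P 1 && P 2 && P 3 && P 4 && P 5 && P 6

theorem forallFin_spec {P : Fin 7 → Bool} (h : forallFin P = true) (i : Fin 7) : P i = true := by
  simp only [forallFin, Bool.and_eq_true] at h
  obtain ⟨⟨⟨⟨⟨⟨h0, h1⟩, h2⟩, h3⟩, h4⟩, h5⟩, h6⟩ := h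
  fin_cases i <;> assumption

theorem codes_cover :
    forallFin (fun a1 => !(isNew a1 [0]) ||
    forallFin (fun a2 => !(isNew a2 [0, a1]) ||
    forallFin (fun a3 => !(isNew a3 [0, a1, a2]) ||
    forallFin (fun a4 => !(isNew a4 [0, a1, a2, a3]) ||
    forallFin (fun a5 => !(isNew a5 [0, a1, a2, a3, a4]) ||
    forallFin (fun a6 => !(isNew a6 [0, a1, a2, a3, a4, a5]) ||
      (inCodes a1 a2 a3 a4 a5 a6 || inCodes a2 a1 a3 a4 a5 a6))))))) = true := by
  decide +kernel

theorem isNew_of {c : Fin 7} {l : List (Fin 7)} (h : ∀ d ∈ l, c ≠ d) : isNew c l = true := by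
  simp only [isNew, List.all_eq_true]
  intro d hd
  have h1 : c.val ≠ d.val := fun e => h d hd (Fin.ext e)
  cases h2 : Nat.beq c.val d.val with
  | false => rfl
  | true => exact absurd (Nat.eq_of_beq_eq_true h2) h1

theorem perm_inCodes (p : Equiv.Perm (Fin 7)) (h0 : p 0 = 0) :
    inCodes (p 1) (p 2) (p 3) (p 4) (p 5) (p 6) = true ∨
    inCodes (p 2) (p 1) (p 3) (p 4) (p 5) (p 6) = true := by
  have key : ∀ i j : Fin 7, i ≠ j → p i ≠ p j := fun i j h e => h (p.injective e)
  have step : ∀ {b c : Bool}, (!b || c) = true → b = true → c = true := by decide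
  have h1 := step (forallFin_spec codes_cover (p 1)) (isNew_of (by
    rw [← h0]; simp [key]))
  have h2 := step (forallFin_spec h1 (p 2)) (isNew_of (by rw [← h0]; simp))
  have h3 := step (forallFin_spec h2 (p 3)) (isNew_of (by rw [← h0]; simp))
  have h4 := step (forallFin_spec h3 (p 4)) (isNew_of (by rw [← h0]; simp))
  have h5 := step (forallFin_spec h4 (p 5)) (isNew_of (by rw [← h0]; simp))
  have h6 := step (forallFin_spec h5 (p 6)) (isNew_of (by rw [← h0]; simp))
  simpa using h6

theorem aenc_inj {p q : Equiv.Perm (Fin 7)} (hp : p 0 = 0) (hq : q 0 = 0) (h : aenc p = aenc q) :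
    p = q := by
  unfold aenc at h
  ext i
  have := (p 1).isLt
  have := (p 2).isLt
  have := (p 3).isLt
  have := (p 4).isLt
  have := (p 5).isLt
  have := (q 1).isLt
  have := (q 2).isLt
  have := (q 3).isLt
  have := (q 4).isLt
  have := (q 5).isLt
  fin_cases i
  · simp [hp, hq]
  all_goals simp only [Fin.reduceFinMk]; omega

theorem stab_mul {p q : Equiv.Perm (Fin 7)} (hp : p 0 = 0) (hq : q 0 = 0) : (p * q) 0 = 0 := by
  rw [Equiv.Perm.mul_apply, hq, hp]

theorem stab_pow {p : Equiv.Perm (Fin 7)} (hp : p 0 = 0) (n : ℕ) : (p ^ n) 0 = 0 := by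
  induction n with
  | zero => rfl
  | succ n ih => rw [pow_succ]; exact stab_mul ih hp

theorem hword_zero (i j : Fin 3) (k : Fin 4) : hword i j k 0 = 0 :=
  stab_mul (stab_mul (stab_pow (by decide) _) (stab_pow (by decide) _)) (stab_pow (by decide) _)

theorem nword_zero (i j : Fin 3) : nword i j 0 = 0 :=
  stab_mul (stab_mul (stab_pow (by decide) _) (stab_pow (by decide) _)) (by decide)

theorem inCodes_word (p : Equiv.Perm (Fin 7)) (h0 : p 0 = 0)
    (h : inCodes (p 1) (p 2) (p 3) (p 4) (p 5) (p 6) = true) :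
    (∃ i j k, p = hword i j k) ∨ ∃ i j i' j' k, p = nword i j * hword i' j' k := by
  rw [inCodes, List.any_eq_true] at h
  obtain ⟨n, hn, h⟩ := h
  have h1 : n = aenc p := Nat.eq_of_beq_eq_true h
  rw [h1, List.mem_append, ← hcodes_eq, ← ncodes_eq] at hn
  simp only [List.mem_flatMap, List.mem_map, List.mem_finRange, true_and] at hn
  rcases hn with ⟨i, j, k, hn⟩ | ⟨i, j, i', j', k, hn⟩
  · exact Or.inl ⟨i, j, k, aenc_inj h0 (hword_zero _ _ _) hn.symm⟩
  · exact Or.inr ⟨i, j, i', j', k,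
      aenc_inj h0 (stab_mul (nword_zero _ _) (hword_zero _ _ _)) hn.symm⟩

theorem pa_mem : pa ∈ A6 := by
  refine ⟨?_, ?_⟩
  · refine Equiv.Perm.mem_alternatingGroup.2 ?_; decide +kernel
  · exact (by decide : pa 0 = 0)

theorem pb_mem : pb ∈ A6 := by
  refine ⟨?_, ?_⟩
  · refine Equiv.Perm.mem_alternatingGroup.2 ?_; decide +kernel
  · exact (by decide : pb 0 = 0)

theorem px_mem : px ∈ A6 := by
  refine ⟨?_, ?_⟩
  · refine Equiv.Perm.mem_alternatingGroup.2 ?_; decide +kernel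
  · exact (by decide : px 0 = 0)

theorem pw_mem : pww ∈ A6 := by
  refine ⟨?_, ?_⟩
  · refine Equiv.Perm.mem_alternatingGroup.2 ?_; decide +kernel
  · exact (by decide : pww 0 = 0)

theorem swap_not_mem : Equiv.swap (1 : Fin 7) 2 ∉ A6 := by
  rintro ⟨h, -⟩
  replace h := Equiv.Perm.mem_alternatingGroup.1 h
  rw [Equiv.Perm.sign_swap (by decide)] at h
  exact absurd h (by decide)

theorem hword_mem (i j : Fin 3) (k : Fin 4) : hword i j k ∈ A6 :=
  mul_mem (mul_mem (pow_mem pa_mem _) (pow_mem pb_mem _)) (pow_mem px_mem _)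

theorem nword_mem (i j : Fin 3) : nword i j ∈ A6 :=
  mul_mem (mul_mem (pow_mem pa_mem _) (pow_mem pb_mem _)) pw_mem

theorem A6_words (p : Equiv.Perm (Fin 7)) (hp : p ∈ A6) :
    (∃ i j k, p = hword i j k) ∨ ∃ i j i' j' k, p = nword i j * hword i' j' k := by
  have h0 : p 0 = 0 := hp.2
  rcases perm_inCodes p h0 with h | h
  · exact inCodes_word p h0 h
  · exfalso
    have hq := inCodes_word (p * Equiv.swap 1 2) (stab_mul h0 (by decide)) (by
      have e1 : (p * Equiv.swap (1 : Fin 7) 2) 1 = p 2 := by simp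
      have e2 : (p * Equiv.swap (1 : Fin 7) 2) 2 = p 1 := by simp
      have e3 : (p * Equiv.swap (1 : Fin 7) 2) 3 = p 3 := congrArg p (by decide)
      have e4 : (p * Equiv.swap (1 : Fin 7) 2) 4 = p 4 := congrArg p (by decide)
      have e5 : (p * Equiv.swap (1 : Fin 7) 2) 5 = p 5 := congrArg p (by decide)
      have e6 : (p * Equiv.swap (1 : Fin 7) 2) 6 = p 6 := congrArg p (by decide)
      rw [e1, e2, e3, e4, e5, e6]; exact h)
    have hm : p * Equiv.swap 1 2 ∈ A6 := by
      rcases hq with ⟨i, j, k, e⟩ | ⟨i, j, i', j', k, e⟩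
      · rw [e]; exact hword_mem _ _ _
      · rw [e]; exact mul_mem (nword_mem _ _) (hword_mem _ _ _)
    exact swap_not_mem ((Subgroup.mul_mem_cancel_left _ hp).1 hm)
theorem stmt9
    (K : Type) [Field K] [Algebra ℚ K] [IsCyclotomicExtension {4} ℚ K]
    (ζ : K) (hζ : IsPrimitiveRoot ζ 4)
    (x₁ x₂ x₃ : A6)
    (hx₁ : (x₁ : Equiv.Perm (Fin 7)) = c[(3 : Fin 7), 5] * c[(4 : Fin 7), 6])
    (hx₂ : (x₂ : Equiv.Perm (Fin 7)) = c[(1 : Fin 7), 2] * c[(3 : Fin 7), 4, 5, 6])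
    (hx₃ : (x₃ : Equiv.Perm (Fin 7)) = c[(1 : Fin 7), 4, 6])
    -- H 0, …, H 9 : the ten conjugates of H₁ = ⟨x₁, x₂, x₃⟩, with H i = a i • H₁ • (a i)⁻¹
    (H : Fin 10 → Subgroup A6) (a : Fin 10 → A6)
    (hH0 : H 0 = Subgroup.closure {x₁, x₂, x₃})
    (hH : ∀ i, H i = conjSub (a i) (H 0))
    (hHinj : Function.Injective H)
    (hHcompl : ∀ T : Subgroup A6, (∃ g : A6, T = conjSub g (H 0)) → ∃ i, T = H i)
    -- η₁ : the degree-1 character of H₁ with η₁((1,2)(3,4,5,6)) = √-1 = ζ,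
    -- η₁((1,4,6)) = 1, η₁((3,5)(4,6)) = -1
    (η₁ : (H 0 : Subgroup A6) →* K)
    (hη₂ : ∀ h : x₂ ∈ H 0, η₁ ⟨x₂, h⟩ = ζ)
    (hη₃ : ∀ h : x₃ ∈ H 0, η₁ ⟨x₃, h⟩ = 1)
    (hη₁x : ∀ h : x₁ ∈ H 0, η₁ ⟨x₁, h⟩ = -1)
    -- η i : the character of H i with η i (a i · x · (a i)⁻¹) = η₁(x)
    (η : ∀ i, (H i : Subgroup A6) →* K)
    (hηtr : ∀ (i) (x : A6) (hx : x ∈ H 0) (hx' : a i * x * (a i)⁻¹ ∈ H i),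
      η i ⟨a i * x * (a i)⁻¹, hx'⟩ = η₁ ⟨x, hx⟩)
    -- the irreducible character of A₆ of degree 10
    (V : FDRep K A6) (hV : CategoryTheory.Simple V) (hdim : Module.finrank K V = 10) :
    cenIdem V.character 10 = ∑ i, subIdem (H i) (η i) ∧
    ∀ i j, subIdem (H i) (η i) * subIdem (H j) (η j) =
      if i = j then subIdem (H i) (η i) else 0 := by
  have : CharZero K := algebraRat.charZero K
  have hζ2 : ζ * ζ = -1 := by
    have h4 : ζ ^ 4 = 1 := hζ.pow_eq_one
    have h2 : ζ ^ 2 ≠ 1 := hζ.pow_ne_one_of_pos_of_lt (by norm_num) (by norm_num)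
    have h : (ζ ^ 2 - 1) * (ζ * ζ + 1) = 0 := by linear_combination h4
    exact eq_neg_of_add_eq_zero_left ((mul_eq_zero.1 h).resolve_left (sub_ne_zero.2 h2))
  obtain ⟨b, hb⟩ : ∃ b : A6, (b : Equiv.Perm (Fin 7)) = pb := ⟨⟨pb, pb_mem⟩, rfl⟩
  obtain ⟨w, hw⟩ : ∃ w : A6, (w : Equiv.Perm (Fin 7)) = pww := ⟨⟨pww, pw_mem⟩, rfl⟩
  have hx : (x₂ : Equiv.Perm (Fin 7)) = px := hx₂
  have ha : (x₃ : Equiv.Perm (Fin 7)) = pa := hx₃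
  have h12 : x₁ = x₂ * x₂ := by
    apply Subtype.ext
    rw [hx₁, Subgroup.coe_mul, hx]
    decide +kernel
  subst h12
  have hxa : x₂ * x₃ = b * x₂ := by
    apply Subtype.ext; simp only [Subgroup.coe_mul, hx, ha, hb]; decide +kernel
  have hxH : x₂ ∈ H 0 := by rw [hH0]; exact Subgroup.subset_closure (by simp)
  have haH : x₃ ∈ H 0 := by rw [hH0]; exact Subgroup.subset_closure (by simp)
  have hbH : b ∈ H 0 := by
    have : b = x₂ * x₃ * x₂⁻¹ := by rw [hxa, mul_inv_cancel_right]
    rw [this]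
    exact mul_mem (mul_mem hxH haH) (inv_mem hxH)
  have hcov : ∀ g : A6, g ∈ H 0 ∨
      ∃ i j : Fin 3, ∃ h ∈ H 0, g = x₃ ^ (i : ℕ) * b ^ (j : ℕ) * w * h := by
    intro g
    have hm : ∀ (i j : Fin 3) (k : Fin 4), x₃ ^ (i : ℕ) * b ^ (j : ℕ) * x₂ ^ (k : ℕ) ∈ H 0 :=
      fun i j k => mul_mem (mul_mem (pow_mem haH _) (pow_mem hbH _)) (pow_mem hxH _)
    rcases A6_words g g.2 with ⟨i, j, k, e⟩ | ⟨i, j, i', j', k, e⟩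
    · left
      have : g = x₃ ^ (i : ℕ) * b ^ (j : ℕ) * x₂ ^ (k : ℕ) := by
        apply Subtype.ext
        simp only [Subgroup.coe_mul, Subgroup.coe_pow, hx, ha, hb]
        exact e
      rw [this]; exact hm i j k
    · right
      refine ⟨i, j, _, hm i' j' k, ?_⟩
      apply Subtype.ext
      simp only [Subgroup.coe_mul, Subgroup.coe_pow, hx, ha, hb, hw]
      exact e
  have hwx : x₂ * w * x₂ = w := by
    apply Subtype.ext; simp only [Subgroup.coe_mul, hx, hw]; decide +kernel
  have hvec := aux_vec (K := K) (V := V) hdim V.ρ (aux_simple V hV) ζ hζ2 (H 0) x₃ b x₂ w hH0 hcov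
    ?_ ?_ ?_ ?_ hxa ?_ ?_ hwx ?_ ?_ ?_ ?_ ?_ ?_ ?_ ?_
  · exact aux_main (K := K) (V := V) hdim V.ρ ζ hζ2 H a x₃ b x₂ w hH0 hH hHinj hcov hbH hwx η₁
      hη₂ hη₃ η hηtr hvec
  all_goals
    apply Subtype.ext
    simp only [Subgroup.coe_mul, Subgroup.coe_one, hx, ha, hb, hw]
    decide +kernel
end
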